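/- arXiv:2103.04888 — 2 statements merged into one kernel-verified Lean document; each statement's English description precedes it below -/
import Mathlib

section
/- (Numerical Factorization Theorem, part (iv): forward accuracy) Let m ∈ ℕ^ℓ, m ≠ 0, let 𝔑 be a factorization structure of degree m, let f̃ ∈ F^𝔑 with irreducible factorization f̃ = α̃·f̃_1^{k_1}⋯f̃_r^{k_r} and full factor list (with multiplicities) of length k := k_1 + ⋯ + k_r; for f ∈ ℙ^m put δ_f := dist(f, F^𝔑). Then there exist a neighborhood Ω of f̃ in ℙ^m and a constant η > 0 such that for every f ∈ Ω and every ε with δ_f < ε < θ_{f̃}/2, every numerical irreducible factorization of f within ε has a full factor list of the same length k (in particular it has the same factorization structure 𝔑 as f̃), and its factorization distance to the factorization of f̃ is at most η·‖f − f̃‖. -/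
open scoped Classical

/-- The Hermitian inner product on coefficients of multivariate polynomials
(conjugate-linear in the first argument). -/
noncomputable def pInner {ℓ : ℕ} (p q : MvPolynomial (Fin ℓ) ℂ) : ℂ :=
  ∑ d ∈ p.support ∪ q.support, (starRingEnd ℂ) (MvPolynomial.coeff d p) * MvPolynomial.coeff d q

/-- The coefficient norm `‖p‖ := √⟪p,p⟫`. -/
noncomputable def pNorm {ℓ : ℕ} (p : MvPolynomial (Fin ℓ) ℂ) : ℝ :=
  Real.sqrt (pInner p p).re

/-- The sine of the principal angle between the spans of two polynomials. -/
noncomputable def psin {ℓ : ℕ} (p q : MvPolynomial (Fin ℓ) ℂ) : ℝ :=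
  if p = 0 then (if q = 0 then 0 else 1)
  else if q = 0 then 1
  else pNorm (((pNorm p : ℂ))⁻¹ • p -
        (pInner q p / ((pNorm q : ℂ) * (pNorm p : ℂ))) • (((pNorm q : ℂ))⁻¹ • q))

/-- `(r, mdeg, k)` is a factorization structure of degree `m`: `r ≥ 1`, each `mdeg j ≠ 0`,
each `k j ≥ 1` and `Σ_j k_j · mdeg_j = m`. -/
def IsStruct {ℓ : ℕ} (m : Fin ℓ → ℕ) (r : ℕ) (mdeg : Fin r → Fin ℓ → ℕ)
    (k : Fin r → ℕ) : Prop :=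
  1 ≤ r ∧ (∀ j, mdeg j ≠ 0) ∧ (∀ j, 1 ≤ k j) ∧ (∀ t, ∑ j, k j * mdeg j t = m t)

/-- The factorization manifold `F^𝔐` of the structure `𝔐 = ((mdeg 1, k 1),…,(mdeg r, k r))`. -/
def FMset {ℓ : ℕ} (r : ℕ) (mdeg : Fin r → Fin ℓ → ℕ) (k : Fin r → ℕ) :
    Set (MvPolynomial (Fin ℓ) ℂ) :=
  {f | ∃ (β : ℂ) (g : Fin r → MvPolynomial (Fin ℓ) ℂ), β ≠ 0 ∧
        (∀ i, Irreducible (g i)) ∧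
        (∀ i t, (g i).degreeOf t = mdeg i t) ∧
        (∀ i j : Fin r, i ≠ j → ¬ Associated (g i) (g j)) ∧
        f = MvPolynomial.C β * ∏ i, g i ^ k i}

/-- `⟨n⟩ = ∏_t (n_t + 1)`, the dimension of `ℙ^n`. -/
def dimC {ℓ : ℕ} (n : Fin ℓ → ℕ) : ℕ := ∏ t, (n t + 1)

/-- The codimension `⟨m⟩ − (⟨m_1⟩ + ⋯ + ⟨m_r⟩ + 1 − r)` of a factorization manifold. -/
def codimOf {ℓ : ℕ} (m : Fin ℓ → ℕ) {r : ℕ} (mdeg : Fin r → Fin ℓ → ℕ) : ℤ :=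
  (dimC m : ℤ) - ((∑ j, (dimC (mdeg j) : ℤ)) + 1 - r)

/-- `dist(f, S) = inf_{g ∈ S} ‖f − g‖`, with value `+∞` for `S = ∅`. -/
noncomputable def distE {ℓ : ℕ} (f : MvPolynomial (Fin ℓ) ℂ)
    (S : Set (MvPolynomial (Fin ℓ) ℂ)) : ENNReal :=
  ⨅ g ∈ S, ENNReal.ofReal (pNorm (f - g))

/-- Closure of a set of polynomials in the coefficient-norm topology. -/
def pclosure {ℓ : ℕ} (S : Set (MvPolynomial (Fin ℓ) ℂ)) : Set (MvPolynomial (Fin ℓ) ℂ) :=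
  {f | ∀ ε : ℝ, 0 < ε → ∃ g ∈ S, pNorm (f - g) < ε}

/-- The critical gap `θ_f`: the infimum of `dist(f, F^𝔐)` over all factorization
structures `𝔐` of degree `m` with `f ∉ closure(F^𝔐)` (`+∞` if there are none). -/
noncomputable def theta {ℓ : ℕ} (m : Fin ℓ → ℕ) (f : MvPolynomial (Fin ℓ) ℂ) : ENNReal :=
  ⨅ (r : ℕ) (mdeg : Fin r → Fin ℓ → ℕ) (k : Fin r → ℕ)
    (_ : IsStruct m r mdeg k) (_ : f ∉ pclosure (FMset r mdeg k)),
    distE f (FMset r mdeg k)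

/-- `α·f_1^{k_1}⋯f_r^{k_r}` is a numerical irreducible factorization of `f` within `ε`:
the `f_j` are irreducible and pairwise non-associated, the structure
`𝔐 = ((deg f_1,k_1),…,(deg f_r,k_r))` is a factorization structure of degree `m` of
maximal codimension among structures `𝔑` of degree `m` with `dist(f,F^𝔑) < ε`, and
`min_γ ‖f − γ·f_1^{k_1}⋯f_r^{k_r}‖` is attained and equals `dist(f,F^𝔐) < ε`. -/
noncomputable def IsNIF {ℓ : ℕ} (m : Fin ℓ → ℕ) (f : MvPolynomial (Fin ℓ) ℂ) (ε : ℝ)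
    (α : ℂ) (r : ℕ) (fs : Fin r → MvPolynomial (Fin ℓ) ℂ) (ks : Fin r → ℕ) : Prop :=
  α ≠ 0 ∧ (∀ j, Irreducible (fs j)) ∧
  (∀ i j : Fin r, i ≠ j → ¬ Associated (fs i) (fs j)) ∧
  IsStruct m r (fun j t => (fs j).degreeOf t) ks ∧
  (∀ (r' : ℕ) (mdeg' : Fin r' → Fin ℓ → ℕ) (k' : Fin r' → ℕ),
    IsStruct m r' mdeg' k' → distE f (FMset r' mdeg' k') < ENNReal.ofReal ε →
    codimOf m mdeg' ≤ codimOf m (fun j t => (fs j).degreeOf t)) ∧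
  (∃ γ : ℂ,
    (∀ γ' : ℂ, pNorm (f - MvPolynomial.C γ * ∏ j, fs j ^ ks j) ≤
      pNorm (f - MvPolynomial.C γ' * ∏ j, fs j ^ ks j)) ∧
    ENNReal.ofReal (pNorm (f - MvPolynomial.C γ * ∏ j, fs j ^ ks j)) =
      distE f (FMset r (fun j t => (fs j).degreeOf t) ks)) ∧
  distE f (FMset r (fun j t => (fs j).degreeOf t) ks) < ENNReal.ofReal ε

/-- The full factor list (each factor repeated with its multiplicity) of a factorization. -/
def fullList {ℓ : ℕ} (r : ℕ) (fs : Fin r → MvPolynomial (Fin ℓ) ℂ) (ks : Fin r → ℕ) :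
    List (MvPolynomial (Fin ℓ) ℂ) :=
  (List.ofFn fun j => List.replicate (ks j) (fs j)).flatten

/-- The distance between two factorizations given by their full factor lists: `1` if the
lengths differ, otherwise the minimum over permutations `σ` of `max_j sin(p_j, q_{σ(j)})`. -/
noncomputable def factDistL {ℓ : ℕ} (l₁ l₂ : List (MvPolynomial (Fin ℓ) ℂ)) : ℝ :=
  if h : l₁.length = l₂.length then
    if h0 : 0 < l₁.length then
      (Finset.univ : Finset (Equiv.Perm (Fin l₁.length))).inf' ⟨1, Finset.mem_univ _⟩
        (fun σ => (Finset.univ : Finset (Fin l₁.length)).sup' ⟨⟨0, h0⟩, Finset.mem_univ _⟩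
          (fun j => psin (l₁.get j) (l₂.get (Fin.cast h (σ j)))))
    else 0
  else 1

section Weights

theorem prod_add_one_superadditive {ι : Type*} (s : Finset ι) (a b : ι → ℕ) :
    ∏ t ∈ s, (a t + 1) + ∏ t ∈ s, (b t + 1) ≤ ∏ t ∈ s, (a t + b t + 1) + 1 := by
  induction s using Finset.induction_on with
  | empty => simp
  | insert t s ht ih =>
    rw [Finset.prod_insert ht, Finset.prod_insert ht, Finset.prod_insert ht]
    have hA : ∏ t ∈ s, (a t + 1) ≤ ∏ t ∈ s, (a t + b t + 1) :=
      Finset.prod_le_prod' fun i _ => by omega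
    have hB : ∏ t ∈ s, (b t + 1) ≤ ∏ t ∈ s, (a t + b t + 1) :=
      Finset.prod_le_prod' fun i _ => by omega
    nlinarith [Nat.mul_le_mul_left (a t) hA, Nat.mul_le_mul_left (b t) hB]

theorem prod_add_one_strict_superadditive {ι : Type*} [Fintype ι] (a b : ι → ℕ) {s t : ι} (hst : s ≠ t)
    (hs : a s ≠ 0) (ht : b t ≠ 0) :
    ∏ i, (a i + 1) + ∏ i, (b i + 1) < ∏ i, (a i + b i + 1) + 1 := by
  have key := prod_add_one_superadditive (Finset.univ.erase t) a b
  rw [← Finset.mul_prod_erase Finset.univ (fun i => a i + 1) (Finset.mem_univ t),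
    ← Finset.mul_prod_erase Finset.univ (fun i => b i + 1) (Finset.mem_univ t),
    ← Finset.mul_prod_erase Finset.univ (fun i => a i + b i + 1) (Finset.mem_univ t)]
  have hA : ∏ t ∈ Finset.univ.erase t, (a t + 1) ≤ ∏ t ∈ Finset.univ.erase t, (a t + b t + 1) :=
    Finset.prod_le_prod' fun i _ => by omega
  have hB : ∏ t ∈ Finset.univ.erase t, (b t + 1) < ∏ t ∈ Finset.univ.erase t, (a t + b t + 1) :=
    Finset.prod_lt_prod (fun i _ => by omega) (fun i _ => by omega)
      ⟨s, by simp [hst], by omega⟩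
  nlinarith [Nat.mul_le_mul_left (a t) hA,
    Nat.mul_lt_mul_of_pos_left hB (Nat.pos_of_ne_zero ht)]

theorem exists_ne_of_support_not_singleton {ι : Type*} (a b : ι → ℕ) (ha : a ≠ 0) (hb : b ≠ 0)
    (hab : ¬ ∃ t, a t ≠ 0 ∧ b t ≠ 0 ∧ ∀ s, s ≠ t → a s + b s = 0) :
    ∃ s t, s ≠ t ∧ a s ≠ 0 ∧ b t ≠ 0 := by
  by_contra! h
  obtain ⟨s, hs⟩ := Function.ne_iff.mp ha
  obtain ⟨t, ht⟩ := Function.ne_iff.mp hb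
  simp only [Pi.zero_apply] at hs ht
  have hst : s = t := by
    by_contra hst
    exact ht (h s t hst hs)
  subst hst
  refine hab ⟨s, hs, ht, fun i hi => ?_⟩
  have h1 := h s i (Ne.symm hi) hs
  have h2 : a i = 0 := by
    by_contra h3
    exact ht (h i s hi h3)
  omega

end Weights

section Algebra

open MvPolynomial

variable {σ : Type*}

theorem degreeOf_eq_zero_of_isUnit {p : MvPolynomial σ ℂ} (hp : IsUnit p) (t : σ) :
    p.degreeOf t = 0 := by
  obtain ⟨c, -, rfl⟩ := isUnit_iff_eq_C_of_isReduced.mp hp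
  simp

theorem isUnit_of_degreeOf_eq_zero {p : MvPolynomial σ ℂ} (hp : p ≠ 0)
    (h : ∀ t, p.degreeOf t = 0) : IsUnit p := by
  obtain ⟨c, hc⟩ : ∃ c, p = C c := by
    refine ⟨coeff 0 p, (totalDegree_eq_zero_iff_eq_C).mp ?_⟩
    rw [totalDegree_eq_zero_iff]
    intro d hd t
    exact Nat.le_zero.mp ((h t) ▸ monomial_le_degreeOf t hd)
  subst hc
  exact (isUnit_iff_ne_zero.mpr (by simpa using hp)).map C

theorem degreeOf_eq_of_associated {p q : MvPolynomial σ ℂ} (h : Associated p q) (t : σ) :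
    p.degreeOf t = q.degreeOf t := by
  obtain ⟨u, rfl⟩ := h
  by_cases hp : p = 0
  · simp [hp]
  · rw [degreeOf_mul_eq hp u.ne_zero, degreeOf_eq_zero_of_isUnit u.isUnit, add_zero]

theorem associated_of_dvd_of_degreeOf_le {p q : MvPolynomial σ ℂ} (hq : q ≠ 0) (hpq : p ∣ q)
    (h : ∀ t, q.degreeOf t ≤ p.degreeOf t) : Associated p q := by
  obtain ⟨c, rfl⟩ := hpq
  have hp := left_ne_zero_of_mul hq
  have hc := right_ne_zero_of_mul hq
  refine associated_mul_unit_right p c (isUnit_of_degreeOf_eq_zero hc fun t => ?_)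
  have := h t
  rw [degreeOf_mul_eq hp hc] at this
  omega

theorem exists_C_mul_of_associated {p q : MvPolynomial σ ℂ} (h : Associated p q) :
    ∃ c : ℂ, c ≠ 0 ∧ q = C c * p := by
  obtain ⟨u, rfl⟩ := h
  obtain ⟨c, hc, hu⟩ := isUnit_iff_eq_C_of_isReduced.mp u.isUnit
  exact ⟨c, hc.ne_zero, by rw [hu, mul_comm]⟩

theorem Irreducible.degreeOf_le_one_of_univariate {g : MvPolynomial σ ℂ} (hg : Irreducible g)
    {t : σ} (h : ∀ s, s ≠ t → g.degreeOf s = 0) : g.degreeOf t ≤ 1 := by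
  by_contra! hdeg
  have hmem : g ∈ supported ℂ ({t} : Set σ) := by
    rw [mem_supported]
    intro s hs
    by_contra hst
    have : g.degreeOf s = 0 := h s (by simpa using hst)
    rw [Finset.mem_coe, mem_vars_iff_mem_support] at hs
    obtain ⟨d, hd, hs⟩ := hs
    have := monomial_le_degreeOf s hd
    rw [Finsupp.mem_support_iff] at hs
    omega
  rw [supported_eq_adjoin_X, Set.image_singleton, Algebra.adjoin_singleton_eq_range_aeval] at hmem
  obtain ⟨p, hp⟩ := hmem
  have hp0 : p.degree ≠ 0 := by
    intro h0
    rw [Polynomial.eq_C_of_degree_eq_zero h0] at hp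
    simp only [RingHom.coe_coe, AlgHom.toRingHom_eq_coe, Polynomial.aeval_C] at hp
    rw [← hp] at hdeg
    simp [algebraMap_eq] at hdeg
  obtain ⟨c, hc⟩ := IsAlgClosed.exists_root p hp0
  obtain ⟨q, rfl⟩ := Polynomial.dvd_iff_isRoot.mpr hc
  have hfac : g = (X t - C c) * Polynomial.aeval (X t : MvPolynomial σ ℂ) q := by
    rw [← hp]; simp [algebraMap_eq]
  have hlin : (X t - C c : MvPolynomial σ ℂ).degreeOf t = 1 := by
    rw [sub_eq_add_neg, ← C_neg, degreeOf_add_eq_of_degreeOf_lt] <;> simp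
  rcases hg.isUnit_or_isUnit hfac with hu | hu
  · rw [degreeOf_eq_zero_of_isUnit hu] at hlin
    omega
  · have h0 := hg.ne_zero
    rw [hfac] at h0
    rw [hfac, degreeOf_mul_eq (left_ne_zero_of_mul h0) hu.ne_zero, hlin,
      degreeOf_eq_zero_of_isUnit hu] at hdeg
    omega

theorem not_dvd_prod_pow_of_not_associated {ι : Type*} {q : ι → MvPolynomial σ ℂ}
    (hirr : ∀ i, Irreducible (q i)) (hna : ∀ i j, i ≠ j → ¬ Associated (q i) (q j))
    (k : ι → ℕ) (i : ι) (s : Finset ι) (his : i ∉ s) : ¬ q i ∣ ∏ j ∈ s, q j ^ k j := by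
  intro h
  obtain ⟨j, hj, hdvd⟩ := (hirr i).prime.exists_mem_finset_dvd h
  have := ((hirr i).prime.dvd_of_dvd_pow hdvd)
  exact hna i j (fun e => his (e ▸ hj)) ((hirr i).associated_of_dvd (hirr j) this)

theorem exponent_le_of_pow_dvd_prod_pow {ι : Type*} [Fintype ι] {q : ι → MvPolynomial σ ℂ}
    (hirr : ∀ i, Irreducible (q i)) (hna : ∀ i j, i ≠ j → ¬ Associated (q i) (q j))
    {b : ι → ℕ} {i : ι} {n : ℕ} (h : q i ^ n ∣ ∏ j, q j ^ b j) : n ≤ b i := by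
  rw [← Finset.mul_prod_erase _ _ (Finset.mem_univ i)] at h
  have := (hirr i).prime.pow_dvd_of_dvd_mul_right n
    (not_dvd_prod_pow_of_not_associated hirr hna b i _ (by simp)) h
  exact (pow_dvd_pow_iff (hirr i).ne_zero (hirr i).not_isUnit).mp this

theorem exponents_eq_of_associated_prod_pow {ι : Type*} [Fintype ι] {q : ι → MvPolynomial σ ℂ}
    (hirr : ∀ i, Irreducible (q i)) (hna : ∀ i j, i ≠ j → ¬ Associated (q i) (q j))
    {a b : ι → ℕ} (h : Associated (∏ j, q j ^ a j) (∏ j, q j ^ b j)) : a = b := by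
  funext i
  refine le_antisymm ?_ ?_
  · exact exponent_le_of_pow_dvd_prod_pow hirr hna
      ((Finset.dvd_prod_of_mem (fun j => q j ^ a j) (Finset.mem_univ i)).trans h.dvd)
  · exact exponent_le_of_pow_dvd_prod_pow hirr hna
      ((Finset.dvd_prod_of_mem (fun j => q j ^ b j) (Finset.mem_univ i)).trans h.symm.dvd)

theorem associated_C_mul {c : ℂ} (hc : c ≠ 0) (p : MvPolynomial σ ℂ) :
    Associated p (C c * p) :=
  associated_unit_mul_right p _ ((isUnit_iff_ne_zero.mpr hc).map C)

/-- Infinitesimal uniqueness of factorizations: each component of a tangent vector annihilated by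
the differential of `(q_j) ↦ ∏ q_j ^ k_j` modulo scalars is divisible by the matching factor. -/
theorem dvd_of_tangent_relation {ι : Type*} [Fintype ι] [DecidableEq ι]
    {q : ι → MvPolynomial σ ℂ}
    (hirr : ∀ i, Irreducible (q i)) (hna : ∀ i j, i ≠ j → ¬ Associated (q i) (q j))
    {k : ι → ℕ} (hk : ∀ i, 1 ≤ k i) {v : ι → MvPolynomial σ ℂ} {β : ℂ}
    (h : C β * ∏ j, q j ^ k j =
      ∑ j, ((k j : MvPolynomial σ ℂ) * v j * q j ^ (k j - 1)) *
        ∏ i ∈ Finset.univ.erase j, q i ^ k i)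
    (j : ι) : q j ∣ v j := by
  rw [← Finset.add_sum_erase _ _ (Finset.mem_univ j)] at h
  have hrest : q j ^ k j ∣ ∑ i ∈ Finset.univ.erase j,
      ((k i : MvPolynomial σ ℂ) * v i * q i ^ (k i - 1)) *
        ∏ l ∈ Finset.univ.erase i, q l ^ k l := by
    refine Finset.dvd_sum fun i hi => Dvd.dvd.mul_left ?_ _
    exact Finset.dvd_prod_of_mem (fun l => q l ^ k l)
      (by simpa using (Finset.ne_of_mem_erase hi).symm)
  have hall : q j ^ k j ∣ C β * ∏ j, q j ^ k j :=
    Dvd.dvd.mul_left (Finset.dvd_prod_of_mem (fun l => q l ^ k l) (Finset.mem_univ j)) _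
  rw [h, dvd_add_left hrest] at hall
  have h1 := (hirr j).prime.pow_dvd_of_dvd_mul_right (k j)
    (not_dvd_prod_pow_of_not_associated hirr hna k j _ (by simp)) hall
  obtain ⟨n, hn⟩ : ∃ n, k j = n + 1 := ⟨k j - 1, by have := hk j; omega⟩
  rw [hn, Nat.add_sub_cancel, pow_succ', mul_dvd_mul_iff_right
    (pow_ne_zero _ (hirr j).ne_zero)] at h1
  rcases (hirr j).prime.dvd_or_dvd h1 with h2 | h2
  · exfalso
    have hu : IsUnit (((n + 1 : ℕ) : MvPolynomial σ ℂ)) := by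
      rw [← map_natCast (C : ℂ →+* MvPolynomial σ ℂ)]
      exact (isUnit_iff_ne_zero.mpr (by exact_mod_cast Nat.succ_ne_zero n)).map C
    exact (hirr j).not_isUnit (isUnit_of_dvd_unit h2 hu)
  · exact h2

end Algebra

section Codimension

open MvPolynomial

variable {ℓ : ℕ}

/-- `⟨deg p⟩ - 1`, the dimension of the projective space of polynomials of degree at most
`deg p`. -/
noncomputable def projDim (p : MvPolynomial (Fin ℓ) ℂ) : ℤ :=
  (dimC (fun t => p.degreeOf t) : ℤ) - 1

theorem projDim_nonneg (p : MvPolynomial (Fin ℓ) ℂ) : 0 ≤ projDim p := by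
  have : 0 < dimC (fun t => p.degreeOf t) := Finset.prod_pos fun t _ => Nat.succ_pos _
  unfold projDim
  omega

theorem projDim_pos {p : MvPolynomial (Fin ℓ) ℂ} (hp : p ≠ 0) (hu : ¬ IsUnit p) :
    0 < projDim p := by
  obtain ⟨t, ht⟩ : ∃ t, p.degreeOf t ≠ 0 := by
    by_contra! h
    exact hu (isUnit_of_degreeOf_eq_zero hp h)
  have : ∏ _t : Fin ℓ, 1 < dimC (fun t => p.degreeOf t) :=
    Finset.prod_lt_prod (fun _ _ => one_pos) (fun _ _ => by omega)
      ⟨t, Finset.mem_univ t, Nat.succ_lt_succ (Nat.pos_of_ne_zero ht)⟩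
  rw [Finset.prod_const_one] at this
  unfold projDim
  omega

theorem projDim_add_le_mul {p q : MvPolynomial (Fin ℓ) ℂ} (hp : p ≠ 0) (hq : q ≠ 0) :
    projDim p + projDim q ≤ projDim (p * q) := by
  have := prod_add_one_superadditive Finset.univ (fun t => p.degreeOf t) (fun t => q.degreeOf t)
  simp only [projDim, dimC, degreeOf_mul_eq hp hq]
  omega

theorem projDim_add_lt_mul {p q g : MvPolynomial (Fin ℓ) ℂ} (hp : p ≠ 0) (hq : q ≠ 0)
    (hpu : ¬ IsUnit p) (hqu : ¬ IsUnit q) (hg : Irreducible g)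
    (hdeg : ∀ t, g.degreeOf t = (p * q).degreeOf t) :
    projDim p + projDim q < projDim (p * q) := by
  simp only [degreeOf_mul_eq hp hq] at hdeg
  obtain ⟨s, t, hst, hs, ht⟩ := exists_ne_of_support_not_singleton
    (fun t => p.degreeOf t) (fun t => q.degreeOf t)
    (fun h => hpu (isUnit_of_degreeOf_eq_zero hp (congrFun h)))
    (fun h => hqu (isUnit_of_degreeOf_eq_zero hq (congrFun h))) (by
      rintro ⟨t, hpt, hqt, h⟩
      have := hg.degreeOf_le_one_of_univariate (t := t) fun s hs => by rw [hdeg, h s hs]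
      rw [hdeg] at this
      omega)
  have := prod_add_one_strict_superadditive
    (fun t => p.degreeOf t) (fun t => q.degreeOf t) hst hs ht
  simp only [projDim, dimC, degreeOf_mul_eq hp hq]
  omega

theorem projDim_le_of_dvd {p q : MvPolynomial (Fin ℓ) ℂ} (hq : q ≠ 0) (h : p ∣ q) :
    projDim p ≤ projDim q := by
  obtain ⟨c, rfl⟩ := h
  have := projDim_add_le_mul (left_ne_zero_of_mul hq) (right_ne_zero_of_mul hq)
  have := projDim_nonneg c
  omega

theorem sum_projDim_le_prod {ι : Type*} (s : Finset ι) (p : ι → MvPolynomial (Fin ℓ) ℂ)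
    (hp : ∀ i, p i ≠ 0) : ∑ i ∈ s, projDim (p i) ≤ projDim (∏ i ∈ s, p i) := by
  induction s using Finset.induction_on with
  | empty => simpa using projDim_nonneg _
  | insert i s hi ih =>
    rw [Finset.sum_insert hi, Finset.prod_insert hi]
    have := projDim_add_le_mul (hp i) (Finset.prod_ne_zero_iff.mpr fun j (_ : j ∈ s) => hp j)
    omega

/-- If a polynomial with irreducible factors `q_i` also factors as `γ ∏ h_j ^ k_j`, where each
`h_j` has the degree of some irreducible polynomial, and the second factorization has no larger
dimension count than the first, then the two factorizations agree up to order and scalars. -/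
theorem exists_equiv_of_sum_projDim_le {r s : ℕ} {q : Fin s → MvPolynomial (Fin ℓ) ℂ}
    {h : Fin r → MvPolynomial (Fin ℓ) ℂ} {n : Fin s → ℕ} {k : Fin r → ℕ} {α γ : ℂ}
    (hirr : ∀ i, Irreducible (q i)) (hna : ∀ i j, i ≠ j → ¬ Associated (q i) (q j))
    (hn : ∀ i, 1 ≤ n i) (hα : α ≠ 0)
    (hh : ∀ j, h j ≠ 0) (hnu : ∀ j, ¬ IsUnit (h j))
    (hdeg : ∀ j, ∃ g : MvPolynomial (Fin ℓ) ℂ, Irreducible g ∧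
      ∀ t, g.degreeOf t = (h j).degreeOf t)
    (hprod : C α * ∏ i, q i ^ n i = C γ * ∏ j, h j ^ k j)
    (hdim : ∑ j, projDim (h j) ≤ ∑ i, projDim (q i)) :
    ∃ e : Fin r ≃ Fin s, ∀ j, Associated (h j) (q (e j)) ∧ k j = n (e j) := by
  have hγ : γ ≠ 0 := by
    rintro rfl
    rw [C_0, zero_mul] at hprod
    exact mul_ne_zero (by simpa using hα)
      (Finset.prod_ne_zero_iff.mpr fun i _ => pow_ne_zero _ (hirr i).ne_zero) hprod
  have hass : Associated (∏ i, q i ^ n i) (∏ j, h j ^ k j) :=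
    (associated_C_mul hα _).trans (hprod ▸ (associated_C_mul hγ _).symm)
  have hφ : ∀ i, ∃ j, q i ∣ h j := by
    intro i
    have h1 : q i ∣ ∏ j, h j ^ k j :=
      ((dvd_pow_self (q i) (by have := hn i; omega)).trans
        (Finset.dvd_prod_of_mem (fun i => q i ^ n i) (Finset.mem_univ i))).trans hass.dvd
    obtain ⟨j, -, hj⟩ := (hirr i).prime.exists_mem_finset_dvd h1
    exact ⟨j, (hirr i).prime.dvd_of_dvd_pow hj⟩
  choose φ hφ using hφ
  have hrel : ∀ i j, i ≠ j → IsRelPrime (q i) (q j) := fun i j hij =>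
    (hirr i).isRelPrime_iff_not_dvd.mpr fun hd =>
      hna i j hij ((hirr i).associated_of_dvd (hirr j) hd)
  have hfib : ∀ (j) (S : Finset (Fin s)), (∀ i ∈ S, φ i = j) → ∏ i ∈ S, q i ∣ h j :=
    fun j S hS => Finset.prod_dvd_of_isRelPrime (fun i _ i' _ hii => hrel i i' hii)
      fun i hi => hS i hi ▸ hφ i
  have hle : ∀ j ∈ Finset.univ, ∑ i with φ i = j, projDim (q i) ≤ projDim (h j) := fun j _ =>
    (sum_projDim_le_prod _ q fun i => (hirr i).ne_zero).trans
      (projDim_le_of_dvd (hh j) (hfib j _ (by simp)))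
  have hsum : ∑ j, ∑ i with φ i = j, projDim (q i) = ∑ j, projDim (h j) :=
    le_antisymm (Finset.sum_le_sum hle) (hdim.trans_eq
      (Finset.sum_fiberwise Finset.univ φ fun i => projDim (q i)).symm)
  have heq := (Finset.sum_eq_sum_iff_of_le hle).mp hsum
  have hqa : ∀ i, Associated (h (φ i)) (q i) := by
    intro i
    obtain ⟨c, hc⟩ := hφ i
    have hqc : q i * c ≠ 0 := hc ▸ hh (φ i)
    have hc0 := right_ne_zero_of_mul hqc
    by_cases hcu : IsUnit c
    · rw [hc]
      exact (associated_mul_unit_right (q i) c hcu).symm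
    · exfalso
      obtain ⟨g, hg, hgdeg⟩ := hdeg (φ i)
      have hlt := projDim_add_lt_mul (hirr i).ne_zero hc0 (hirr i).not_isUnit hcu hg
        (fun t => by rw [hgdeg, hc])
      have hmem : i ∈ Finset.univ.filter fun i' => φ i' = φ i := by simp
      have hd := hfib (φ i) (Finset.univ.filter fun i' => φ i' = φ i) (by simp)
      rw [← Finset.mul_prod_erase _ _ hmem, hc, mul_dvd_mul_iff_left (hirr i).ne_zero] at hd
      have h1 := (sum_projDim_le_prod _ q fun i => (hirr i).ne_zero).trans
        (projDim_le_of_dvd hc0 hd)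
      have h2 := heq (φ i) (Finset.mem_univ _)
      rw [← Finset.add_sum_erase _ _ hmem, hc] at h2
      omega
  have hinj : Function.Injective φ := by
    intro i i' hii
    by_contra hne
    exact hna i i' hne ((hqa i).symm.trans (hii ▸ hqa i'))
  have hsurj : Function.Surjective φ := by
    intro j
    by_contra! hj
    have h1 := heq j (Finset.mem_univ j)
    rw [Finset.filter_false_of_mem (by simpa using hj), Finset.sum_empty] at h1
    exact (projDim_pos (hh j) (hnu j)).ne h1
  let e := Equiv.ofBijective φ ⟨hinj, hsurj⟩
  have hexp : n = fun i => k (φ i) := by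
    refine exponents_eq_of_associated_prod_pow hirr hna (hass.trans ?_)
    rw [← Equiv.prod_comp e]
    exact Associated.prod _ _ _ fun i _ => (hqa i).pow_pow
  refine ⟨e.symm, fun j => ?_⟩
  obtain ⟨i, rfl⟩ := e.surjective j
  rw [Equiv.symm_apply_apply]
  exact ⟨hqa i, (congrFun hexp i).symm⟩

end Codimension

section CoefficientNorm

open MvPolynomial

variable {ℓ : ℕ}

theorem pInner_eq_sum_of_subset {p q : MvPolynomial (Fin ℓ) ℂ} {T : Finset (Fin ℓ →₀ ℕ)}
    (hp : p.support ⊆ T) :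
    pInner p q = ∑ d ∈ T, (starRingEnd ℂ) (coeff d p) * coeff d q := by
  trans ∑ d ∈ p.support, (starRingEnd ℂ) (coeff d p) * coeff d q
  · refine (Finset.sum_subset Finset.subset_union_left fun d _ hd => ?_).symm
    rw [notMem_support_iff.mp hd, map_zero, zero_mul]
  · refine Finset.sum_subset hp fun d _ hd => ?_
    rw [notMem_support_iff.mp hd, map_zero, zero_mul]

theorem pInner_C_mul_right (c : ℂ) (q p : MvPolynomial (Fin ℓ) ℂ) :
    pInner q (C c * p) = c * pInner q p := by
  simp only [pInner_eq_sum_of_subset (subset_refl q.support), coeff_C_mul, Finset.mul_sum]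
  exact Finset.sum_congr rfl fun d _ => by ring

theorem pInner_sub_right (q p p' : MvPolynomial (Fin ℓ) ℂ) :
    pInner q (p - p') = pInner q p - pInner q p' := by
  simp only [pInner_eq_sum_of_subset (subset_refl q.support), coeff_sub, mul_sub,
    Finset.sum_sub_distrib]

theorem pInner_C_mul_left (c : ℂ) (q p : MvPolynomial (Fin ℓ) ℂ) :
    pInner (C c * q) p = (starRingEnd ℂ) c * pInner q p := by
  have hsub : (C c * q).support ⊆ q.support := by
    intro d hd
    rw [mem_support_iff, coeff_C_mul] at hd
    exact mem_support_iff.mpr (right_ne_zero_of_mul hd)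
  simp only [pInner_eq_sum_of_subset hsub, pInner_eq_sum_of_subset (subset_refl q.support),
    coeff_C_mul, Finset.mul_sum, map_mul]
  exact Finset.sum_congr rfl fun d _ => by ring

theorem pInner_self_eq_sum {p : MvPolynomial (Fin ℓ) ℂ} {T : Finset (Fin ℓ →₀ ℕ)}
    (hp : p.support ⊆ T) : pInner p p = ((∑ d ∈ T, ‖coeff d p‖ ^ 2 : ℝ) : ℂ) := by
  rw [pInner_eq_sum_of_subset hp]
  push_cast
  exact Finset.sum_congr rfl fun d _ => RCLike.conj_mul _

theorem pNorm_eq_sqrt_sum {p : MvPolynomial (Fin ℓ) ℂ} {T : Finset (Fin ℓ →₀ ℕ)}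
    (hp : p.support ⊆ T) : pNorm p = Real.sqrt (∑ d ∈ T, ‖coeff d p‖ ^ 2) := by
  rw [pNorm, pInner_self_eq_sum hp, Complex.ofReal_re]

theorem pNorm_eq_norm_toLp {p : MvPolynomial (Fin ℓ) ℂ} {T : Finset (Fin ℓ →₀ ℕ)}
    (hp : p.support ⊆ T) :
    pNorm p = ‖(WithLp.toLp 2 fun d : T => coeff d.1 p : EuclideanSpace ℂ T)‖ := by
  rw [pNorm_eq_sqrt_sum hp, EuclideanSpace.norm_eq]
  congr 1
  exact (Finset.sum_coe_sort T fun d => ‖coeff d p‖ ^ 2).symm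

theorem pNorm_nonneg (p : MvPolynomial (Fin ℓ) ℂ) : 0 ≤ pNorm p := Real.sqrt_nonneg _

theorem pInner_self (p : MvPolynomial (Fin ℓ) ℂ) : pInner p p = (pNorm p : ℂ) ^ 2 := by
  rw [pNorm_eq_sqrt_sum (subset_refl p.support), pInner_self_eq_sum (subset_refl p.support),
    ← Complex.ofReal_pow, Real.sq_sqrt (Finset.sum_nonneg fun d _ => sq_nonneg _)]

theorem norm_coeff_le_pNorm (p : MvPolynomial (Fin ℓ) ℂ) (d : Fin ℓ →₀ ℕ) :
    ‖coeff d p‖ ≤ pNorm p := by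
  by_cases hd : d ∈ p.support
  · rw [pNorm_eq_sqrt_sum (subset_refl p.support)]
    exact Real.le_sqrt_of_sq_le (Finset.single_le_sum (f := fun d => ‖coeff d p‖ ^ 2)
      (fun _ _ => sq_nonneg _) hd)
  · rw [notMem_support_iff.mp hd, norm_zero]
    exact pNorm_nonneg p

theorem pNorm_ne_zero {p : MvPolynomial (Fin ℓ) ℂ} (hp : p ≠ 0) : pNorm p ≠ 0 := by
  intro h
  refine hp (MvPolynomial.ext _ _ fun d => ?_)
  rw [coeff_zero, ← norm_le_zero_iff, ← h]
  exact norm_coeff_le_pNorm p d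

theorem pNorm_zero : pNorm (0 : MvPolynomial (Fin ℓ) ℂ) = 0 := by
  simp [pNorm, pInner]

theorem pNorm_add_le (p q : MvPolynomial (Fin ℓ) ℂ) : pNorm (p + q) ≤ pNorm p + pNorm q := by
  rw [pNorm_eq_norm_toLp (p := p + q) (T := p.support ∪ q.support) support_add,
    pNorm_eq_norm_toLp (p := p) (T := p.support ∪ q.support) Finset.subset_union_left,
    pNorm_eq_norm_toLp (p := q) (T := p.support ∪ q.support) Finset.subset_union_right]
  refine (le_of_eq ?_).trans (norm_add_le _ _)
  congr 1

theorem pNorm_C_mul (c : ℂ) (p : MvPolynomial (Fin ℓ) ℂ) : pNorm (C c * p) = ‖c‖ * pNorm p := by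
  have hsub : (C c * p).support ⊆ p.support := by
    intro d hd
    rw [mem_support_iff, coeff_C_mul] at hd
    exact mem_support_iff.mpr (right_ne_zero_of_mul hd)
  rw [pNorm_eq_norm_toLp hsub, pNorm_eq_norm_toLp (subset_refl p.support), ← norm_smul]
  congr 1
  ext d
  simp

theorem pNorm_sub_comm (p q : MvPolynomial (Fin ℓ) ℂ) : pNorm (p - q) = pNorm (q - p) := by
  have : p - q = C (-1) * (q - p) := by rw [C_neg, C_1]; ring
  rw [this, pNorm_C_mul, norm_neg, norm_one, one_mul]

theorem pNorm_sub_le (p q s : MvPolynomial (Fin ℓ) ℂ) :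
    pNorm (p - s) ≤ pNorm (p - q) + pNorm (q - s) := by
  rw [← sub_add_sub_cancel p q s]
  exact pNorm_add_le _ _

/-- The orthogonal projection coefficient of `p` along `q`. -/
noncomputable def projCoeff (q p : MvPolynomial (Fin ℓ) ℂ) : ℂ := pInner q p / pInner q q

/-- The unit vector in the direction of `p`. -/
noncomputable def pUnit (p : MvPolynomial (Fin ℓ) ℂ) : MvPolynomial (Fin ℓ) ℂ :=
  C ((pNorm p : ℂ)⁻¹) * p

theorem pNorm_pUnit {p : MvPolynomial (Fin ℓ) ℂ} (hp : p ≠ 0) : pNorm (pUnit p) = 1 := by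
  rw [pUnit, pNorm_C_mul, norm_inv, Complex.norm_real, Real.norm_of_nonneg (pNorm_nonneg p),
    inv_mul_cancel₀ (pNorm_ne_zero hp)]

theorem C_pNorm_mul_pUnit {p : MvPolynomial (Fin ℓ) ℂ} (hp : p ≠ 0) :
    C (pNorm p : ℂ) * pUnit p = p := by
  rw [pUnit, ← mul_assoc, ← C_mul, mul_inv_cancel₀ (by exact_mod_cast pNorm_ne_zero hp), C_1,
    one_mul]

theorem pInner_self_ne_zero {p : MvPolynomial (Fin ℓ) ℂ} (hp : p ≠ 0) : pInner p p ≠ 0 := by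
  rw [pInner_self]
  exact pow_ne_zero _ (by exact_mod_cast pNorm_ne_zero hp)

theorem psin_eq {p q : MvPolynomial (Fin ℓ) ℂ} (hp : p ≠ 0) (hq : q ≠ 0) :
    psin p q = pNorm (pUnit p - C (projCoeff q (pUnit p)) * q) := by
  rw [psin, if_neg hp, if_neg hq, smul_eq_C_mul, smul_eq_C_mul, smul_eq_C_mul, ← mul_assoc,
    ← C_mul, projCoeff, pUnit, pInner_C_mul_right, pInner_self]
  congr 4
  have := pNorm_ne_zero hp
  have := pNorm_ne_zero hq
  field_simp

theorem pInner_sub_proj {q : MvPolynomial (Fin ℓ) ℂ} (hq : q ≠ 0)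
    (p : MvPolynomial (Fin ℓ) ℂ) : pInner q (p - C (projCoeff q p) * q) = 0 := by
  rw [pInner_sub_right, pInner_C_mul_right, projCoeff, div_mul_cancel₀ _ (pInner_self_ne_zero hq),
    sub_self]

theorem psin_C_mul_right {c : ℂ} (hc : c ≠ 0) {p q : MvPolynomial (Fin ℓ) ℂ} (hp : p ≠ 0)
    (hq : q ≠ 0) : psin p (C c * q) = psin p q := by
  have hcq : C c * q ≠ 0 := mul_ne_zero (by simpa using hc) hq
  rw [psin_eq hp hcq, psin_eq hp hq, projCoeff, projCoeff, pInner_C_mul_left,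
    pInner_C_mul_left, pInner_C_mul_right, ← mul_assoc, ← C_mul]
  congr 4
  have h1 := pInner_self_ne_zero hq
  have h2 : (starRingEnd ℂ) c ≠ 0 := by simpa using hc
  field_simp

theorem eq_zero_of_dvd_of_pInner_eq_zero {q v : MvPolynomial (Fin ℓ) ℂ} (hq : q ≠ 0)
    (hdvd : q ∣ v) (hdeg : ∀ t, v.degreeOf t ≤ q.degreeOf t) (h : pInner q v = 0) : v = 0 := by
  by_contra hv
  obtain ⟨c, hc, rfl⟩ := exists_C_mul_of_associated (associated_of_dvd_of_degreeOf_le hv hdvd hdeg)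
  rw [pInner_C_mul_right] at h
  exact mul_ne_zero hc (pInner_self_ne_zero hq) h

end CoefficientNorm

section CoefficientConvergence

open MvPolynomial Filter Topology

variable {ℓ : ℕ} {ι : Type*} {l : Filter ι}

/-- Coefficientwise convergence of polynomials. -/
def CoeffTendsto (l : Filter ι) (p : ι → MvPolynomial (Fin ℓ) ℂ)
    (q : MvPolynomial (Fin ℓ) ℂ) : Prop :=
  ∀ d, Tendsto (fun s => coeff d (p s)) l (𝓝 (coeff d q))

namespace CoeffTendsto

variable {p p' : ι → MvPolynomial (Fin ℓ) ℂ} {q q' : MvPolynomial (Fin ℓ) ℂ}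

theorem const (q : MvPolynomial (Fin ℓ) ℂ) : CoeffTendsto l (fun _ => q) q :=
  fun _ => tendsto_const_nhds

theorem add (h : CoeffTendsto l p q) (h' : CoeffTendsto l p' q') :
    CoeffTendsto l (fun s => p s + p' s) (q + q') := fun d => by
  simpa only [coeff_add] using (h d).add (h' d)

theorem sub (h : CoeffTendsto l p q) (h' : CoeffTendsto l p' q') :
    CoeffTendsto l (fun s => p s - p' s) (q - q') := fun d => by
  simpa only [coeff_sub] using (h d).sub (h' d)

theorem mul (h : CoeffTendsto l p q) (h' : CoeffTendsto l p' q') :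
    CoeffTendsto l (fun s => p s * p' s) (q * q') := fun d => by
  simp only [coeff_mul]
  exact tendsto_finsetSum _ fun x _ => (h x.1).mul (h' x.2)

theorem C_mul {c : ι → ℂ} {a : ℂ} (hc : Tendsto c l (𝓝 a)) (h : CoeffTendsto l p q) :
    CoeffTendsto l (fun s => C (c s) * p s) (C a * q) := fun d => by
  simp only [coeff_C_mul]
  exact hc.mul (h d)

theorem pow (h : CoeffTendsto l p q) (n : ℕ) : CoeffTendsto l (fun s => p s ^ n) (q ^ n) := by
  induction n with
  | zero => simpa using const (l := l) (1 : MvPolynomial (Fin ℓ) ℂ)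
  | succ n ih => simpa only [pow_succ] using ih.mul h

theorem sum {κ : Type*} (S : Finset κ) {p : ι → κ → MvPolynomial (Fin ℓ) ℂ}
    {q : κ → MvPolynomial (Fin ℓ) ℂ} (h : ∀ j, CoeffTendsto l (fun s => p s j) (q j)) :
    CoeffTendsto l (fun s => ∑ j ∈ S, p s j) (∑ j ∈ S, q j) := fun d => by
  simp only [coeff_sum]
  exact tendsto_finsetSum _ fun j _ => h j d

theorem prod {κ : Type*} (S : Finset κ) {p : ι → κ → MvPolynomial (Fin ℓ) ℂ}
    {q : κ → MvPolynomial (Fin ℓ) ℂ} (h : ∀ j, CoeffTendsto l (fun s => p s j) (q j)) :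
    CoeffTendsto l (fun s => ∏ j ∈ S, p s j) (∏ j ∈ S, q j) := by
  induction S using Finset.induction_on with
  | empty => simpa using const (l := l) (1 : MvPolynomial (Fin ℓ) ℂ)
  | insert j S hj ih => simpa only [Finset.prod_insert hj] using (h j).mul ih

theorem unique [l.NeBot] (h : CoeffTendsto l p q) (h' : CoeffTendsto l p q') : q = q' :=
  MvPolynomial.ext _ _ fun d => tendsto_nhds_unique (h d) (h' d)

theorem of_pNorm_sub (h : Tendsto (fun s => pNorm (p s - q)) l (𝓝 0)) : CoeffTendsto l p q :=
  fun d => by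
    rw [tendsto_iff_norm_sub_tendsto_zero]
    refine squeeze_zero (fun _ => norm_nonneg _) (fun s => ?_) h
    rw [← coeff_sub]
    exact norm_coeff_le_pNorm _ d

theorem pInner_right (g : MvPolynomial (Fin ℓ) ℂ) (h : CoeffTendsto l p q) :
    Tendsto (fun s => pInner g (p s)) l (𝓝 (pInner g q)) := by
  simp only [pInner_eq_sum_of_subset (subset_refl g.support)]
  exact tendsto_finsetSum _ fun d _ => (h d).const_mul _

/-- Scalar factors of a convergent family converge if the remaining factor has a nonzero limit. -/
theorem exists_tendsto_scalar {c : ι → ℂ} (h : CoeffTendsto l p q) (hq : q ≠ 0)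
    (h' : CoeffTendsto l (fun s => C (c s) * p s) q') : ∃ a, Tendsto c l (𝓝 a) := by
  obtain ⟨d, hd⟩ := ne_zero_iff.mp hq
  refine ⟨coeff d q' / coeff d q, ((h' d).div (h d) hd).congr' ?_⟩
  filter_upwards [(h d).eventually_ne hd] with s hs
  simp only [Pi.div_apply, coeff_C_mul]
  rw [mul_div_assoc, div_self hs, mul_one]

end CoeffTendsto

/-- The exponents of degree at most `m`. -/
noncomputable def expBox (m : Fin ℓ → ℕ) : Finset (Fin ℓ →₀ ℕ) :=
  Finset.Iic (Finsupp.equivFunOnFinite.symm m)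

theorem mem_expBox {m : Fin ℓ → ℕ} {d : Fin ℓ →₀ ℕ} : d ∈ expBox m ↔ ∀ t, d t ≤ m t := by
  rw [expBox, Finset.mem_Iic]
  rfl

theorem support_subset_expBox {m : Fin ℓ → ℕ} {p : MvPolynomial (Fin ℓ) ℂ} :
    p.support ⊆ expBox m ↔ ∀ t, p.degreeOf t ≤ m t := by
  simp only [degreeOf_le_iff, Finset.subset_iff, mem_expBox]
  exact ⟨fun h t d hd => h hd t, fun h d hd t => h t d hd⟩

theorem CoeffTendsto.degreeOf_le [l.NeBot] {m : Fin ℓ → ℕ} {p : ι → MvPolynomial (Fin ℓ) ℂ}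
    {q : MvPolynomial (Fin ℓ) ℂ} (h : CoeffTendsto l p q)
    (hp : ∀ s t, (p s).degreeOf t ≤ m t) (t : Fin ℓ) : q.degreeOf t ≤ m t := by
  refine support_subset_expBox.mp (fun d hd => ?_) t
  by_contra hdm
  refine mem_support_iff.mp hd (tendsto_nhds_unique (h d) (tendsto_const_nhds.congr fun s => ?_))
  exact (notMem_support_iff.mp fun hds => hdm (support_subset_expBox.mpr (hp s) hds)).symm

theorem CoeffTendsto.tendsto_pNorm [l.NeBot] {m : Fin ℓ → ℕ} {p : ι → MvPolynomial (Fin ℓ) ℂ}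
    {q : MvPolynomial (Fin ℓ) ℂ} (h : CoeffTendsto l p q)
    (hp : ∀ s t, (p s).degreeOf t ≤ m t) : Tendsto (fun s => pNorm (p s)) l (𝓝 (pNorm q)) := by
  simp only [fun s => pNorm_eq_sqrt_sum (support_subset_expBox.mpr (hp s)),
    pNorm_eq_sqrt_sum (support_subset_expBox.mpr (h.degreeOf_le hp))]
  exact (tendsto_finsetSum _ fun d _ => (h d).norm.pow 2).sqrt

theorem exists_coeffTendsto (l : Ultrafilter ι) {m : Fin ℓ → ℕ} {p : ι → MvPolynomial (Fin ℓ) ℂ}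
    (hp : ∀ s t, (p s).degreeOf t ≤ m t) (hn : ∀ s, pNorm (p s) ≤ 1) :
    ∃ q, CoeffTendsto l p q := by
  have hlim : ∀ d, ∃ c, Tendsto (fun s => coeff d (p s)) l (𝓝 c) := by
    intro d
    obtain ⟨c, -, hc⟩ := (isCompact_closedBall (0 : ℂ) 1).ultrafilter_le_nhds
      (l.map fun s => coeff d (p s)) (by
        rw [le_principal_iff, Ultrafilter.mem_coe, Ultrafilter.mem_map]
        exact Filter.univ_mem' fun s => by
          simpa using (norm_coeff_le_pNorm (p s) d).trans (hn s))
    exact ⟨c, hc⟩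
  choose c hc using hlim
  refine ⟨∑ d ∈ expBox m, monomial d (c d), fun d => ?_⟩
  rw [coeff_sum]
  simp only [coeff_monomial, Finset.sum_ite_eq']
  split_ifs with hd
  · exact hc d
  · refine tendsto_const_nhds.congr fun s => ?_
    exact (notMem_support_iff.mp fun hds => hd (support_subset_expBox.mpr (hp s) hds)).symm

end CoefficientConvergence

section LocalFactorization

open MvPolynomial Filter Topology

variable {ℓ : ℕ} {ι : Type*}

theorem degreeOf_C_mul_prod_pow {r : ℕ} {c : ℂ} (hc : c ≠ 0) {g : Fin r → MvPolynomial (Fin ℓ) ℂ}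
    (hg : ∀ j, g j ≠ 0) (k : Fin r → ℕ) (t : Fin ℓ) :
    (C c * ∏ j, g j ^ k j).degreeOf t = ∑ j, k j * (g j).degreeOf t := by
  rw [degreeOf_mul_eq (by simpa using hc)
      (Finset.prod_ne_zero_iff.mpr fun j _ => pow_ne_zero _ (hg j)), degreeOf_C, zero_add,
    degreeOf_prod_eq _ _ fun j _ => pow_ne_zero _ (hg j)]
  exact Finset.sum_congr rfl fun j _ => degreeOf_pow_eq t (g j) (k j) (hg j)

theorem degreeOf_pUnit {p : MvPolynomial (Fin ℓ) ℂ} (hp : p ≠ 0) (t : Fin ℓ) :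
    (pUnit p).degreeOf t = p.degreeOf t :=
  (degreeOf_eq_of_associated (associated_C_mul
    (inv_ne_zero (by exact_mod_cast pNorm_ne_zero hp)) _) t).symm

theorem C_mul_prod_pow_eq_pUnit {r : ℕ} (γ : ℂ) {g : Fin r → MvPolynomial (Fin ℓ) ℂ}
    (hg : ∀ j, g j ≠ 0) (k : Fin r → ℕ) :
    C γ * ∏ j, g j ^ k j =
      C (γ * ∏ j, (pNorm (g j) : ℂ) ^ k j) * ∏ j, pUnit (g j) ^ k j := by
  simp only [C_mul, map_prod, map_pow, mul_assoc, ← Finset.prod_mul_distrib, ← mul_pow,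
    C_pNorm_mul_pUnit (hg _)]

/-- Normalized factorizations converging along an ultrafilter to a polynomial with irreducible
factors `q_i` have factors converging to scalar multiples of the `q_i`, provided their structure
does not have larger dimension. -/
theorem exists_limit_matching (l : Ultrafilter ι) {r s : ℕ} {q : Fin s → MvPolynomial (Fin ℓ) ℂ}
    {n : Fin s → ℕ} {α : ℂ} (hirr : ∀ i, Irreducible (q i))
    (hna : ∀ i j, i ≠ j → ¬ Associated (q i) (q j)) (hn : ∀ i, 1 ≤ n i) (hα : α ≠ 0)
    {k : Fin r → ℕ} (hk : ∀ j, 1 ≤ k j) {g : Fin r → MvPolynomial (Fin ℓ) ℂ}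
    (hg : ∀ j, Irreducible (g j))
    (hsum : ∀ t, ∑ j, k j * (g j).degreeOf t = ∑ i, n i * (q i).degreeOf t)
    (hdim : ∑ j, projDim (g j) ≤ ∑ i, projDim (q i))
    {G : ι → Fin r → MvPolynomial (Fin ℓ) ℂ} {γ : ι → ℂ}
    (hdeg : ∀ x j t, (G x j).degreeOf t = (g j).degreeOf t) (hG : ∀ x j, pNorm (G x j) = 1)
    (hlim : CoeffTendsto l (fun x => C (γ x) * ∏ j, G x j ^ k j) (C α * ∏ i, q i ^ n i)) :
    ∃ (h : Fin r → MvPolynomial (Fin ℓ) ℂ) (γ₀ : ℂ) (e : Fin r ≃ Fin s),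
      (∀ j, CoeffTendsto l (fun x => G x j) (h j)) ∧ Tendsto γ l (𝓝 γ₀) ∧
      C α * ∏ i, q i ^ n i = C γ₀ * ∏ j, h j ^ k j ∧
      (∀ j t, (h j).degreeOf t = (g j).degreeOf t) ∧
      ∀ j, Associated (h j) (q (e j)) ∧ k j = n (e j) := by
  have hlimG : ∀ j, ∃ h, CoeffTendsto l (fun x => G x j) h := fun j =>
    exists_coeffTendsto l (fun x t => (hdeg x j t).le) fun x => (hG x j).le
  choose h hh using hlimG
  have hne : ∀ j, h j ≠ 0 := by
    intro j hj
    have h1 := (hh j).tendsto_pNorm fun x t => (hdeg x j t).le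
    simp only [hG, hj, pNorm_zero] at h1
    exact one_ne_zero (tendsto_nhds_unique tendsto_const_nhds h1)
  have hle : ∀ j t, (h j).degreeOf t ≤ (g j).degreeOf t := fun j =>
    (hh j).degreeOf_le fun x t => (hdeg x j t).le
  have hprodne : ∏ j, h j ^ k j ≠ 0 :=
    Finset.prod_ne_zero_iff.mpr fun j _ => pow_ne_zero _ (hne j)
  have hprodlim : CoeffTendsto l (fun x => ∏ j, G x j ^ k j) (∏ j, h j ^ k j) :=
    CoeffTendsto.prod _ fun j => (hh j).pow (k j)
  obtain ⟨γ₀, hγ⟩ := hprodlim.exists_tendsto_scalar hprodne hlim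
  have heq := hlim.unique (CoeffTendsto.C_mul hγ hprodlim)
  have hγ₀ : γ₀ ≠ 0 := by
    rintro rfl
    rw [C_0, zero_mul] at heq
    exact mul_ne_zero (by simpa using hα)
      (Finset.prod_ne_zero_iff.mpr fun i _ => pow_ne_zero _ (hirr i).ne_zero) heq
  have hdegh : ∀ j t, (h j).degreeOf t = (g j).degreeOf t := by
    intro j t
    have h1 := congrArg (degreeOf t) heq
    rw [degreeOf_C_mul_prod_pow hα fun i => (hirr i).ne_zero, ← hsum,
      degreeOf_C_mul_prod_pow hγ₀ hne] at h1
    have h2 := (Finset.sum_eq_sum_iff_of_le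
      fun j _ => Nat.mul_le_mul_left (k j) (hle j t)).mp h1.symm j (Finset.mem_univ j)
    exact Nat.eq_of_mul_eq_mul_left (hk j) h2
  have hdim' : ∀ j, projDim (h j) = projDim (g j) := fun j => by
    simp only [projDim, hdegh]
  obtain ⟨e, he⟩ := exists_equiv_of_sum_projDim_le hirr hna hn hα hne
    (fun j hu => (hg j).not_isUnit (isUnit_of_degreeOf_eq_zero (hg j).ne_zero fun t => by
      rw [← hdegh, degreeOf_eq_zero_of_isUnit hu]))
    (fun j => ⟨g j, hg j, fun t => (hdegh j t).symm⟩) heq (by simpa only [hdim'] using hdim)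
  exact ⟨h, γ₀, e, hh, hγ, heq, hdegh, he⟩

/-- First-order expansion of `∏ (x_j + τ v_j) ^ k_j` as `τ → 0`. -/
theorem exists_first_order_expansion {l : Filter ι} {κ : Type*} [DecidableEq κ] (S : Finset κ)
    (k : κ → ℕ) {x v : ι → κ → MvPolynomial (Fin ℓ) ℂ} {x₀ v₀ : κ → MvPolynomial (Fin ℓ) ℂ}
    {τ : ι → ℂ} (hx : ∀ j, CoeffTendsto l (fun s => x s j) (x₀ j))
    (hv : ∀ j, CoeffTendsto l (fun s => v s j) (v₀ j)) (hτ : Tendsto τ l (𝓝 0)) :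
    ∃ Q : ι → MvPolynomial (Fin ℓ) ℂ,
      CoeffTendsto l Q (∑ j ∈ S, ((k j : MvPolynomial (Fin ℓ) ℂ) * v₀ j * x₀ j ^ (k j - 1)) *
        ∏ i ∈ S.erase j, x₀ i ^ k i) ∧
      ∀ s, ∏ j ∈ S, (x s j + C (τ s) * v s j) ^ k j = ∏ j ∈ S, x s j ^ k j + C (τ s) * Q s := by
  induction S using Finset.induction_on with
  | empty => exact ⟨fun _ => 0, by simpa using CoeffTendsto.const 0, by simp⟩
  | insert a S ha ih =>
    obtain ⟨Q, hQ, hQeq⟩ := ih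
    have hτv : CoeffTendsto l (fun s => x s a + C (τ s) * v s a) (x₀ a) := by
      simpa using (hx a).add (CoeffTendsto.C_mul hτ (hv a))
    let P : ι → MvPolynomial (Fin ℓ) ℂ := fun s =>
      v s a * ∑ i ∈ Finset.range (k a), (x s a + C (τ s) * v s a) ^ i * x s a ^ (k a - 1 - i)
    have hP : CoeffTendsto l P ((k a : MvPolynomial (Fin ℓ) ℂ) * v₀ a * x₀ a ^ (k a - 1)) := by
      have h1 := (hv a).mul (CoeffTendsto.sum (Finset.range (k a)) fun i =>
        (hτv.pow i).mul ((hx a).pow (k a - 1 - i)))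
      convert h1 using 1
      rw [Finset.sum_congr rfl fun i hi => by
        rw [← pow_add, Nat.add_sub_cancel' (by have := Finset.mem_range.mp hi; omega)]]
      rw [Finset.sum_const, Finset.card_range, nsmul_eq_mul]
      ring
    have hPeq : ∀ s, (x s a + C (τ s) * v s a) ^ k a = x s a ^ k a + C (τ s) * P s := by
      intro s
      have h1 := (Commute.all (x s a + C (τ s) * v s a) (x s a)).mul_geom_sum₂ (k a)
      rw [add_sub_cancel_left, mul_assoc] at h1
      rw [h1, add_sub_cancel]
    refine ⟨fun s => P s * ∏ j ∈ S, x s j ^ k j + x s a ^ k a * Q s + C (τ s) * (P s * Q s),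
      ?_, fun s => ?_⟩
    · have h1 := ((hP.mul (CoeffTendsto.prod S fun j => (hx j).pow (k j))).add
        (((hx a).pow (k a)).mul hQ)).add (CoeffTendsto.C_mul hτ (hP.mul hQ))
      convert h1 using 1
      rw [C_0, zero_mul, add_zero, Finset.sum_insert ha, Finset.erase_insert ha, Finset.mul_sum]
      congr 1
      refine Finset.sum_congr rfl fun j hj => ?_
      have hja : a ≠ j := fun h => ha (h ▸ hj)
      rw [Finset.erase_insert_of_ne hja,
        Finset.prod_insert fun h => ha (Finset.mem_of_mem_erase h)]
      ring
    · rw [Finset.prod_insert ha, Finset.prod_insert ha, hPeq, hQeq]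
      ring

/-- Factors depend Lipschitz continuously, up to order and scalars, on the product within a fixed
factorization structure. -/
theorem exists_local_lipschitz_factors {r : ℕ} {q : Fin r → MvPolynomial (Fin ℓ) ℂ}
    {n : Fin r → ℕ} {α : ℂ} (hirr : ∀ i, Irreducible (q i))
    (hna : ∀ i j, i ≠ j → ¬ Associated (q i) (q j)) (hn : ∀ i, 1 ≤ n i) (hα : α ≠ 0) :
    ∃ ρ : ℝ, 0 < ρ ∧ ∃ η : ℝ, 0 < η ∧ ∀ (γ : ℂ) (g : Fin r → MvPolynomial (Fin ℓ) ℂ),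
      (∀ j, g j ≠ 0) → (∀ j t, (g j).degreeOf t = (q j).degreeOf t) →
      pNorm (C γ * ∏ j, g j ^ n j - C α * ∏ j, q j ^ n j) < ρ →
      ∃ σ : Equiv.Perm (Fin r), ∀ j, n j = n (σ j) ∧
        psin (g j) (q (σ j)) ≤ η * pNorm (C γ * ∏ j, g j ^ n j - C α * ∏ j, q j ^ n j) := by
  by_contra! H
  have H' := fun s : ℕ => H (1 / ((s : ℝ) + 1)) (by positivity) ((s : ℝ) + 1) (by positivity)
  choose γ g hg0 hdeg hlt hbad using H'
  set f := C α * ∏ j, q j ^ n j with hf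
  let l : Ultrafilter ℕ := hyperfilter ℕ
  have hl : (l : Filter ℕ) ≤ atTop := by
    rw [← Nat.cofinite_eq_atTop]
    exact hyperfilter_le_cofinite
  have hinv : Tendsto (fun s : ℕ => 1 / ((s : ℝ) + 1)) l (𝓝 0) :=
    tendsto_one_div_add_atTop_nhds_zero_nat.mono_left hl
  let G : ℕ → Fin r → MvPolynomial (Fin ℓ) ℂ := fun s j => pUnit (g s j)
  let Γ : ℕ → ℂ := fun s => γ s * ∏ j, (pNorm (g s j) : ℂ) ^ n j
  have hF : ∀ s, C (γ s) * ∏ j, g s j ^ n j = C (Γ s) * ∏ j, G s j ^ n j := fun s =>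
    C_mul_prod_pow_eq_pUnit (γ s) (hg0 s) n
  simp only [hF] at hlt hbad
  have hGdeg : ∀ s j t, (G s j).degreeOf t = (q j).degreeOf t := by
    intro s j t
    rw [degreeOf_pUnit (hg0 s j), hdeg]
  obtain ⟨h, Γ₀, e, hGh, hΓ, hfh, hhdeg, hhq⟩ := exists_limit_matching l hirr hna hn hα hn hirr
    (fun _ => rfl) le_rfl hGdeg (fun s j => pNorm_pUnit (hg0 s j))
    (CoeffTendsto.of_pNorm_sub (squeeze_zero (fun _ => pNorm_nonneg _) (fun s => (hlt s).le) hinv))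
  have hhirr : ∀ j, Irreducible (h j) := fun j => (hhq j).1.irreducible_iff.mpr (hirr _)
  have hhna : ∀ i j, i ≠ j → ¬ Associated (h i) (h j) := fun i j hij ha =>
    hna _ _ (e.injective.ne hij) ((hhq i).1.symm.trans (ha.trans (hhq j).1))
  have hΓ₀ : Γ₀ ≠ 0 := by
    rintro rfl
    rw [C_0, zero_mul] at hfh
    exact mul_ne_zero (by simpa using hα)
      (Finset.prod_ne_zero_iff.mpr fun i _ => pow_ne_zero _ (hirr i).ne_zero) hfh
  let c : ℕ → Fin r → ℂ := fun s j => projCoeff (h j) (G s j)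
  let u : ℕ → Fin r → MvPolynomial (Fin ℓ) ℂ := fun s j => G s j - C (c s j) * h j
  have hsin : ∀ s j, psin (g s j) (q (e j)) = pNorm (u s j) := by
    intro s j
    obtain ⟨a, ha, hqa⟩ := exists_C_mul_of_associated (hhq j).1
    rw [hqa, psin_C_mul_right ha (hg0 s j) (hhirr j).ne_zero,
      psin_eq (hg0 s j) (hhirr j).ne_zero]
  have hc : ∀ j, Tendsto (fun s => c s j) l (𝓝 1) := by
    intro j
    have h1 := ((hGh j).pInner_right (h j)).div_const (pInner (h j) (h j))
    rwa [div_self (pInner_self_ne_zero (hhirr j).ne_zero)] at h1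
  have hch : ∀ j, CoeffTendsto l (fun s => C (c s j) * h j) (h j) := by
    intro j
    simpa using CoeffTendsto.C_mul (hc j) (CoeffTendsto.const (h j))
  have hudeg : ∀ s j t, (u s j).degreeOf t ≤ (h j).degreeOf t := by
    intro s j t
    refine (degreeOf_sub_le _ _ _).trans (max_le ?_ (degreeOf_C_mul_le _ _ _))
    rw [hGdeg, hhdeg]
  have hu : ∀ j, CoeffTendsto l (fun s => u s j) 0 := by
    intro j
    simpa using (hGh j).sub (hch j)
  let τ : ℕ → ℝ := fun s => ∑ j, pNorm (u s j)
  have hτ : Tendsto τ l (𝓝 0) := by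
    have h1 := tendsto_finsetSum Finset.univ fun j (_ : j ∈ Finset.univ) =>
      (hu j).tendsto_pNorm fun s t => hudeg s j t
    simpa only [pNorm_zero, Finset.sum_const_zero] using h1
  have hule : ∀ s j, pNorm (u s j) ≤ τ s := fun s j =>
    Finset.single_le_sum (f := fun j => pNorm (u s j)) (fun _ _ => pNorm_nonneg _)
      (Finset.mem_univ j)
  have hbadτ : ∀ s : ℕ, ((s : ℝ) + 1) * pNorm (C (Γ s) * ∏ j, G s j ^ n j - f) < τ s := by
    intro s
    obtain ⟨j, hj⟩ := hbad s e
    have := hj (hhq j).2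
    rw [hsin] at this
    exact this.trans_le (hule s j)
  have hτpos : ∀ s, 0 < τ s := fun s =>
    (mul_nonneg (by positivity) (pNorm_nonneg _)).trans_lt (hbadτ s)
  let v : ℕ → Fin r → MvPolynomial (Fin ℓ) ℂ := fun s j => C ((τ s : ℂ)⁻¹) * u s j
  have hτC : ∀ s, (τ s : ℂ) ≠ 0 := fun s => by exact_mod_cast (hτpos s).ne'
  have hvu : ∀ s j, C (τ s : ℂ) * v s j = u s j := by
    intro s j
    rw [← mul_assoc, ← C_mul, mul_inv_cancel₀ (hτC s), C_1, one_mul]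
  have hvnorm : ∀ s j, pNorm (v s j) = pNorm (u s j) / τ s := by
    intro s j
    rw [pNorm_C_mul, norm_inv, Complex.norm_real, Real.norm_of_nonneg (hτpos s).le,
      div_eq_inv_mul]
  have hvdeg : ∀ s j t, (v s j).degreeOf t ≤ (h j).degreeOf t := fun s j t =>
    (degreeOf_C_mul_le _ _ _).trans (hudeg s j t)
  have hvlim : ∀ j, ∃ v₀, CoeffTendsto l (fun s => v s j) v₀ := fun j =>
    exists_coeffTendsto l (fun s t => hvdeg s j t) fun s => by
      rw [hvnorm]
      exact div_le_one_of_le₀ (hule s j) (hτpos s).le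
  choose v₀ hv₀ using hvlim
  have hvinner : ∀ j, pInner (h j) (v₀ j) = 0 := by
    intro j
    refine tendsto_nhds_unique ((hv₀ j).pInner_right (h j)) (tendsto_const_nhds.congr fun s => ?_)
    rw [pInner_C_mul_right, pInner_sub_proj (hhirr j).ne_zero, mul_zero]
  have hvsum : ∑ j, pNorm (v₀ j) = 1 := by
    refine tendsto_nhds_unique (tendsto_finsetSum Finset.univ fun j _ =>
      (hv₀ j).tendsto_pNorm fun s t => hvdeg s j t) (tendsto_const_nhds.congr fun s => ?_)
    simp only [hvnorm, ← Finset.sum_div]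
    exact (div_self (hτpos s).ne').symm
  have hτ' : Tendsto (fun s => (τ s : ℂ)) l (𝓝 0) := by
    exact_mod_cast (Complex.continuous_ofReal.tendsto 0).comp hτ
  obtain ⟨Q, hQ, hQeq⟩ := exists_first_order_expansion Finset.univ n hch hv₀ hτ'
  have hdiff : CoeffTendsto l
      (fun s => C ((τ s : ℂ)⁻¹) * (C (Γ s) * ∏ j, G s j ^ n j - f)) 0 := by
    refine CoeffTendsto.of_pNorm_sub (squeeze_zero (fun _ => pNorm_nonneg _) (fun s => ?_) hinv)
    rw [sub_zero, pNorm_C_mul, norm_inv, Complex.norm_real, Real.norm_of_nonneg (hτpos s).le,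
      inv_mul_le_iff₀ (hτpos s), mul_one_div, le_div_iff₀ (by positivity), mul_comm]
    exact (hbadτ s).le
  set H := ∏ j, h j ^ n j with hH
  have hexpand : ∀ s, C ((Γ s * ∏ j, c s j ^ n j - Γ₀) / (τ s : ℂ)) * H =
      C ((τ s : ℂ)⁻¹) * (C (Γ s) * ∏ j, G s j ^ n j - f) - C (Γ s) * Q s := by
    intro s
    have h1 : ∏ j, G s j ^ n j = C (∏ j, c s j ^ n j) * H + C (τ s : ℂ) * Q s := by
      have h2 := hQeq s
      simp only [hvu, u, add_sub_cancel] at h2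
      rw [h2, hH]
      simp only [map_prod, map_pow, mul_pow, Finset.prod_mul_distrib]
    have h3 : C ((τ s : ℂ)⁻¹) * C (τ s : ℂ) = (1 : MvPolynomial (Fin ℓ) ℂ) := by
      rw [← C_mul, inv_mul_cancel₀ (hτC s), C_1]
    rw [h1, hf, hfh, div_eq_mul_inv, C_mul, C_sub, C_mul]
    linear_combination (-(C (Γ s) * Q s)) * h3
  have hHne : H ≠ 0 :=
    Finset.prod_ne_zero_iff.mpr fun j _ => pow_ne_zero _ (hhirr j).ne_zero
  have hlimκ := hdiff.sub (CoeffTendsto.C_mul hΓ hQ)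
  simp only [← hexpand] at hlimκ
  obtain ⟨β, hβ⟩ := (CoeffTendsto.const H).exists_tendsto_scalar hHne hlimκ
  have hrel := (CoeffTendsto.C_mul hβ (CoeffTendsto.const H)).unique hlimκ
  have hinvΓ : C (Γ₀⁻¹) * C Γ₀ = (1 : MvPolynomial (Fin ℓ) ℂ) := by
    rw [← C_mul, inv_mul_cancel₀ hΓ₀, C_1]
  have hv0 : ∀ j, v₀ j = 0 := fun j =>
    eq_zero_of_dvd_of_pInner_eq_zero (hhirr j).ne_zero
      (dvd_of_tangent_relation (β := -(Γ₀⁻¹ * β)) hhirr hhna hn (by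
        rw [C_neg, C_mul, ← hH]
        linear_combination (-(C Γ₀⁻¹)) * hrel + (∑ j, ((n j : MvPolynomial (Fin ℓ) ℂ) * v₀ j *
          h j ^ (n j - 1)) * ∏ i ∈ Finset.univ.erase j, h i ^ n i) * hinvΓ) j)
      ((hv₀ j).degreeOf_le fun s t => hvdeg s j t) (hvinner j)
  simp [hv0, pNorm_zero] at hvsum

end LocalFactorization

section FactorLists

variable {ℓ : ℕ}

theorem List.Perm.exists_equiv_get {α : Type*} {l₁ l₂ : List α} (h : l₁.Perm l₂) :
    ∃ e : Fin l₁.length ≃ Fin l₂.length, ∀ i, l₁.get i = l₂.get (e i) := by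
  induction h with
  | nil => exact ⟨Equiv.refl _, fun _ => rfl⟩
  | cons x _ ih =>
    obtain ⟨e, he⟩ := ih
    refine ⟨(finSuccEquiv _).trans ((Equiv.optionCongr e).trans (finSuccEquiv _).symm), ?_⟩
    refine Fin.cases ?_ fun i => ?_
    · simp
    · simpa using he i
  | swap x y l =>
    refine ⟨Equiv.swap (0 : Fin (l.length + 2)) 1, ?_⟩
    refine Fin.cases ?_ (Fin.cases ?_ fun i => ?_)
    · simp
    · simp
    · rw [Equiv.swap_apply_of_ne_of_ne]
      · rfl
      · exact Fin.succ_ne_zero _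
      · exact fun h => Fin.succ_ne_zero i (Fin.succ_injective _ h)
  | trans _ _ ih₁ ih₂ =>
    obtain ⟨e₁, h₁⟩ := ih₁
    obtain ⟨e₂, h₂⟩ := ih₂
    exact ⟨e₁.trans e₂, fun i => (h₁ i).trans (h₂ _)⟩

theorem factDistL_le_of_pairing {L : List (MvPolynomial (Fin ℓ) ℂ × MvPolynomial (Fin ℓ) ℂ)}
    {l : List (MvPolynomial (Fin ℓ) ℂ)} (h : (L.map Prod.snd).Perm l) {B : ℝ} (hB : 0 ≤ B)
    (hL : ∀ x ∈ L, psin x.1 x.2 ≤ B) : factDistL (L.map Prod.fst) l ≤ B := by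
  have hlen : (L.map Prod.fst).length = l.length := by simpa using h.length_eq
  obtain ⟨e, he⟩ := h.exists_equiv_get
  rw [factDistL, dif_pos hlen]
  split_ifs with h0
  · have hlen' : (L.map Prod.fst).length = (L.map Prod.snd).length := by simp
    refine Finset.inf'_le_of_le _
      (Finset.mem_univ (((finCongr hlen').trans e).trans (finCongr hlen.symm))) ?_
    refine Finset.sup'_le _ _ fun j _ => ?_
    have h1 := he (finCongr hlen' j)
    have h2 := hL (L.get (Fin.cast (by simp) j)) (List.get_mem _ _)
    simp only [Equiv.trans_apply, finCongr_apply, Fin.cast_cast, Fin.cast_eq_self] at h1 ⊢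
    rw [← h1]
    simpa using h2
  · exact hB

theorem length_fullList (r : ℕ) (fs : Fin r → MvPolynomial (Fin ℓ) ℂ) (ks : Fin r → ℕ) :
    (fullList r fs ks).length = ∑ j, ks j := by
  simp [fullList, List.length_flatten, List.map_ofFn, Function.comp_def, List.sum_ofFn]

theorem factDistL_fullList_le {r s : ℕ} {fs : Fin r → MvPolynomial (Fin ℓ) ℂ} {ks : Fin r → ℕ}
    {gs : Fin s → MvPolynomial (Fin ℓ) ℂ} {ns : Fin s → ℕ} (e : Fin r ≃ Fin s)
    (hk : ∀ j, ks j = ns (e j)) {B : ℝ} (hB : 0 ≤ B)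
    (h : ∀ j, psin (fs j) (gs (e j)) ≤ B) :
    factDistL (fullList r fs ks) (fullList s gs ns) ≤ B := by
  obtain rfl : r = s := by simpa using Fintype.card_congr e
  let L := (List.ofFn fun j => List.replicate (ks j) (fs j, gs (e j))).flatten
  have hfst : L.map Prod.fst = fullList r fs ks := by
    simp [L, fullList, List.map_flatten, List.map_ofFn, Function.comp_def]
  have hsnd : L.map Prod.snd =
      (List.ofFn fun j => List.replicate (ns (e j)) (gs (e j))).flatten := by
    simp [L, List.map_flatten, List.map_ofFn, Function.comp_def, hk]
  rw [← hfst]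
  refine factDistL_le_of_pairing ?_ hB fun x hx => ?_
  · rw [hsnd]
    exact (Equiv.Perm.ofFn_comp_perm e fun j => List.replicate (ns j) (gs j)).flatten
  · obtain ⟨y, hy, hxy⟩ := List.mem_flatten.mp hx
    obtain ⟨j, rfl⟩ := (List.mem_ofFn' _ _).mp hy
    rw [List.eq_of_mem_replicate hxy]
    exact h j

end FactorLists

section Structures

open MvPolynomial Filter Topology

variable {ℓ : ℕ}

theorem sum_projDim_le_of_codimOf_le {m : Fin ℓ → ℕ} {r s : ℕ}
    {g : Fin r → MvPolynomial (Fin ℓ) ℂ} {q : Fin s → MvPolynomial (Fin ℓ) ℂ}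
    (h : codimOf m (fun i t => (q i).degreeOf t) ≤ codimOf m (fun j t => (g j).degreeOf t)) :
    ∑ j, projDim (g j) ≤ ∑ i, projDim (q i) := by
  simp only [codimOf] at h
  simp only [projDim, Finset.sum_sub_distrib, Finset.sum_const, Finset.card_univ,
    Fintype.card_fin, nsmul_eq_mul, mul_one]
  omega

/-- A structure of maximal codimension whose manifold has a polynomial with irreducible factors
`q_i` in its closure is the structure of that polynomial. -/
theorem exists_equiv_of_mem_pclosure {m : Fin ℓ → ℕ} {r s : ℕ}
    {q : Fin s → MvPolynomial (Fin ℓ) ℂ} {n : Fin s → ℕ} {α : ℂ}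
    (hirr : ∀ i, Irreducible (q i)) (hna : ∀ i j, i ≠ j → ¬ Associated (q i) (q j))
    (hq : IsStruct m s (fun i t => (q i).degreeOf t) n) (hα : α ≠ 0)
    {g : Fin r → MvPolynomial (Fin ℓ) ℂ} {k : Fin r → ℕ} (hgirr : ∀ j, Irreducible (g j))
    (hg : IsStruct m r (fun j t => (g j).degreeOf t) k)
    (hcodim : codimOf m (fun i t => (q i).degreeOf t) ≤ codimOf m (fun j t => (g j).degreeOf t))
    (hcl : C α * ∏ i, q i ^ n i ∈ pclosure (FMset r (fun j t => (g j).degreeOf t) k)) :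
    ∃ e : Fin r ≃ Fin s, ∀ j, (∀ t, (g j).degreeOf t = (q (e j)).degreeOf t) ∧
      k j = n (e j) := by
  have hseq := fun x : ℕ => hcl (1 / ((x : ℝ) + 1)) (by positivity)
  choose p hp hlt using hseq
  choose β G _ hGirr hGdeg _ hpeq using hp
  have hl : ((hyperfilter ℕ : Ultrafilter ℕ) : Filter ℕ) ≤ atTop := by
    rw [← Nat.cofinite_eq_atTop]
    exact hyperfilter_le_cofinite
  have hG0 : ∀ x j, G x j ≠ 0 := fun x j => (hGirr x j).ne_zero
  obtain ⟨h, -, e, -, -, -, hdeg, he⟩ := exists_limit_matching (hyperfilter ℕ) hirr hna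
    hq.2.2.1 hα hg.2.2.1 hgirr (fun t => (hg.2.2.2 t).trans (hq.2.2.2 t).symm)
    (sum_projDim_le_of_codimOf_le hcodim)
    (G := fun x j => pUnit (G x j)) (γ := fun x => β x * ∏ j, (pNorm (G x j) : ℂ) ^ k j)
    (fun x j t => by rw [degreeOf_pUnit (hG0 x j), hGdeg])
    (fun x j => pNorm_pUnit (hG0 x j)) (by
      simp only [← fun x => C_mul_prod_pow_eq_pUnit (β x) (hG0 x) k, ← hpeq]
      refine CoeffTendsto.of_pNorm_sub (squeeze_zero (fun _ => pNorm_nonneg _) (fun x => ?_)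
        (tendsto_one_div_add_atTop_nhds_zero_nat.mono_left hl))
      rw [pNorm_sub_comm]
      exact (hlt x).le)
  exact ⟨e, fun j => ⟨fun t => by rw [← hdeg, degreeOf_eq_of_associated (he j).1], (he j).2⟩⟩

theorem distE_le_of_mem {f g : MvPolynomial (Fin ℓ) ℂ} {S : Set (MvPolynomial (Fin ℓ) ℂ)}
    (hg : g ∈ S) : distE f S ≤ ENNReal.ofReal (pNorm (f - g)) :=
  iInf₂_le g hg

theorem distE_le_add (f g : MvPolynomial (Fin ℓ) ℂ) (S : Set (MvPolynomial (Fin ℓ) ℂ)) :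
    distE f S ≤ ENNReal.ofReal (pNorm (f - g)) + distE g S := by
  simp only [distE, ENNReal.add_iInf]
  refine le_iInf₂ fun p hp => (distE_le_of_mem hp).trans ?_
  rw [← ENNReal.ofReal_add (pNorm_nonneg _) (pNorm_nonneg _)]
  exact ENNReal.ofReal_le_ofReal (pNorm_sub_le f g p)

theorem mem_pclosure_of_distE_lt_half_theta {m : Fin ℓ → ℕ} {f ft : MvPolynomial (Fin ℓ) ℂ} {r : ℕ}
    {mdeg : Fin r → Fin ℓ → ℕ} {k : Fin r → ℕ} (hM : IsStruct m r mdeg k)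
    (hf : ENNReal.ofReal (pNorm (f - ft)) ≤ theta m ft / 2)
    (hd : distE f (FMset r mdeg k) < theta m ft / 2) : ft ∈ pclosure (FMset r mdeg k) := by
  by_contra hcl
  have h1 : theta m ft ≤ distE ft (FMset r mdeg k) :=
    iInf_le_of_le r (iInf_le_of_le mdeg (iInf_le_of_le k (iInf₂_le hM hcl)))
  have h2 := distE_le_add ft f (FMset r mdeg k)
  rw [pNorm_sub_comm] at h2
  have h3 := ENNReal.add_lt_add_of_le_of_lt ENNReal.ofReal_ne_top hf hd
  rw [ENNReal.add_halves] at h3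
  exact absurd (h1.trans h2) (not_le.mpr h3)

end Structures

/-- Numerical Factorization Theorem, part (iv): forward accuracy. Let `f̃ ∈ F^𝔑` have
irreducible factorization `α̃·f̃_1^{k_1}⋯f̃_r^{k_r}` with full factor list of length
`k = k_1 + ⋯ + k_r`. Then near `f̃` there is a constant `η > 0` such that for
`δ_f := dist(f,F^𝔑) < ε < θ_{f̃}/2`, every numerical irreducible factorization of `f`
within `ε` has a full factor list of the same length `k` and its factorization distance to
the factorization of `f̃` is at most `η·‖f − f̃‖`. -/
theorem numerical_factorization_forward_accurate (ℓ : ℕ) (hl : 1 ≤ ℓ) (m : Fin ℓ → ℕ)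
    (hm : m ≠ 0) (rN : ℕ) (ndeg : Fin rN → Fin ℓ → ℕ) (nk : Fin rN → ℕ)
    (hN : IsStruct m rN ndeg nk)
    (αt : ℂ) (fts : Fin rN → MvPolynomial (Fin ℓ) ℂ)
    (hαt : αt ≠ 0) (hirr : ∀ j, Irreducible (fts j))
    (hdeg : ∀ j t, (fts j).degreeOf t = ndeg j t)
    (hassoc : ∀ i j : Fin rN, i ≠ j → ¬ Associated (fts i) (fts j))
    (ft : MvPolynomial (Fin ℓ) ℂ) (hft : ft = MvPolynomial.C αt * ∏ j, fts j ^ nk j) :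
    ∃ ρ η : ℝ, 0 < ρ ∧ 0 < η ∧
      ∀ f : MvPolynomial (Fin ℓ) ℂ, (∀ t, f.degreeOf t ≤ m t) → pNorm (f - ft) < ρ →
        ∀ ε : ℝ, distE f (FMset rN ndeg nk) < ENNReal.ofReal ε →
          ENNReal.ofReal ε < theta m ft / 2 →
          ∀ (α : ℂ) (r : ℕ) (fs : Fin r → MvPolynomial (Fin ℓ) ℂ) (ks : Fin r → ℕ),
            IsNIF m f ε α r fs ks →
            (fullList r fs ks).length = ∑ j, nk j ∧
            factDistL (fullList r fs ks) (fullList rN fts nk) ≤ η * pNorm (f - ft) := by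
  obtain ⟨hN1, hN2, hN3, hN4⟩ := hN
  obtain rfl : ndeg = fun j t => (fts j).degreeOf t := by
    funext j t
    exact (hdeg j t).symm
  subst hft
  set ft := MvPolynomial.C αt * ∏ j, fts j ^ nk j with hft
  obtain ⟨ρ₁, hρ₁, η, hη, hlip⟩ := exists_local_lipschitz_factors hirr hassoc hN3 hαt
  by_cases hθ : theta m ft = 0
  · refine ⟨1, 1, one_pos, one_pos, fun f _ _ ε _ hε => ?_⟩
    simp [hθ] at hε
  obtain ⟨ρ₀, hρ₀, hρθ⟩ : ∃ ρ₀ : ℝ, 0 < ρ₀ ∧ ENNReal.ofReal ρ₀ ≤ theta m ft / 2 := by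
    obtain ⟨x, hx0, hx⟩ := ENNReal.lt_iff_exists_nnreal_btwn.mp (ENNReal.half_pos hθ)
    exact ⟨x, by exact_mod_cast hx0, by simpa using hx.le⟩
  refine ⟨min ρ₀ (ρ₁ / 2), η * 2, lt_min hρ₀ (half_pos hρ₁), by positivity, ?_⟩
  rintro f - hf ε hδ hε α r fs ks ⟨-, hfirr, -, hM, hmax, ⟨γ, -, hγ⟩, hlt⟩
  have hcl := mem_pclosure_of_distE_lt_half_theta hM
    ((ENNReal.ofReal_le_ofReal (hf.le.trans (min_le_left _ _))).trans hρθ) (hlt.trans hε)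
  obtain ⟨e, he⟩ := exists_equiv_of_mem_pclosure hirr hassoc ⟨hN1, hN2, hN3, hN4⟩ hαt hfirr hM
    (hmax rN _ nk ⟨hN1, hN2, hN3, hN4⟩ hδ) hcl
  have hmem : ft ∈ FMset r (fun j t => (fs j).degreeOf t) ks := by
    refine ⟨αt, fun j => fts (e j), hαt, fun j => hirr _, fun j t => ((he j).1 t).symm,
      fun i j hij => hassoc _ _ (e.injective.ne hij), ?_⟩
    simp only [fun j => (he j).2]
    rw [Equiv.prod_comp e fun i => fts i ^ nk i]
  have hback : pNorm (f - MvPolynomial.C γ * ∏ j, fs j ^ ks j) ≤ pNorm (f - ft) :=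
    (ENNReal.ofReal_le_ofReal_iff (pNorm_nonneg _)).mp (hγ.trans_le (distE_le_of_mem hmem))
  have hreindex : ∏ j, fs j ^ ks j = ∏ i, fs (e.symm i) ^ nk i := by
    rw [← Equiv.prod_comp e fun i => fs (e.symm i) ^ nk i]
    simp only [Equiv.symm_apply_apply, fun j => (he j).2]
  have hclose : pNorm (MvPolynomial.C γ * ∏ i, fs (e.symm i) ^ nk i - ft) ≤
      2 * pNorm (f - ft) := by
    have h1 := pNorm_sub_le (MvPolynomial.C γ * ∏ j, fs j ^ ks j) f ft
    rw [pNorm_sub_comm _ f] at h1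
    rw [← hreindex]
    linarith
  obtain ⟨σ, hσ⟩ := hlip γ (fun i => fs (e.symm i)) (fun i => (hfirr _).ne_zero)
    (fun i t => by simpa using (he (e.symm i)).1 t)
    (hclose.trans_lt (by linarith [hf.trans_le (min_le_right ρ₀ (ρ₁ / 2))]))
  refine ⟨?_, factDistL_fullList_le (e.trans σ) (fun j => ?_)
    (mul_nonneg (by positivity) (pNorm_nonneg _)) fun j => ?_⟩
  · rw [length_fullList, ← Equiv.sum_comp e nk]
    exact Finset.sum_congr rfl fun j _ => (he j).2
  · rw [(he j).2]
    exact (hσ (e j)).1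
  · have h1 := (hσ (e j)).2
    rw [Equiv.symm_apply_apply] at h1
    refine h1.trans ?_
    rw [mul_assoc]
    exact mul_le_mul_of_nonneg_left hclose hη.le
end

section
/- Let f ∈ R = MvPolynomial (Fin ℓ) ℂ be nonconstant with a squarefree factorization f = C(α)·h_1^{k_1}⋯h_r^{k_r}, where α ∈ ℂ is nonzero, each h_j is nonconstant and squarefree, h_i and h_j are relatively prime (IsRelPrime) for i ≠ j, and the multiplicities k_1,…,k_r ≥ 1 are pairwise distinct. Let z ∈ ℂ^ℓ and let ∂_z : R → R be the directional derivative ∂_z p := Σ_{i} z_i · (pderiv i p); assume that for each j, ∂_z h_j ≠ 0 and IsRelPrime h_j (∂_z h_j). Let u ∈ R be a greatest common divisor of f and ∂_z f (i.e. u ∣ f, u ∣ ∂_z f, and every common divisor of f and ∂_z f divides u), and let v, w ∈ R satisfy f = u·v and ∂_z f = u·w. Then for every natural number l: (a) if l = k_j for some j, then h_j is a greatest common divisor of v and C(l)·(∂_z v) − w (that is, h_j divides both, and every common divisor of v and C(l)·(∂_z v) − w divides h_j); (b) if l ∉ {k_1,…,k_r}, then IsRelPrime v (C(l)·(∂_z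 v) − w), i.e. every common divisor of v and C(l)·(∂_z v) − w is a unit. -/
open scoped Classical

/-- The directional derivative `∂_z p = Σ_i z_i · ∂p/∂x_i` of a multivariate polynomial
along the direction `z ∈ ℂ^ℓ`. -/
noncomputable def dirDeriv {ℓ : ℕ} (z : Fin ℓ → ℂ) (p : MvPolynomial (Fin ℓ) ℂ) :
    MvPolynomial (Fin ℓ) ℂ :=
  ∑ i, MvPolynomial.C (z i) * MvPolynomial.pderiv i p

open Finset

/-- The weighted logarithmic derivative of `∏ j, h j`, cleared of denominators: the `j`-th factor
is differentiated with weight `c j`. -/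
def weightedDeriv {ι K A : Type*} [Fintype ι] [DecidableEq ι] [Field K] [CommRing A] [Algebra K A]
    (D : Derivation K A A) (h : ι → A) (c : ι → K) : A :=
  ∑ j, c j • (D (h j) * ∏ i ∈ univ.erase j, h i)

section Derivation

variable {ι K A : Type*} [DecidableEq ι] [Field K] [CommRing A] [Algebra K A]
  (D : Derivation K A A)

theorem derivation_prod (s : Finset ι) (g : ι → A) :
    D (∏ j ∈ s, g j) = ∑ j ∈ s, D (g j) * ∏ i ∈ s.erase j, g i := by
  induction s using Finset.induction_on with
  | empty => simp
  | insert a s ha ih =>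
    rw [prod_insert ha, Derivation.leibniz, ih, sum_insert ha, erase_insert ha, smul_eq_mul,
      smul_eq_mul, mul_sum, add_comm, mul_comm]
    congr 1
    refine sum_congr rfl fun j hj => ?_
    have hja : a ≠ j := fun e => ha (e ▸ hj)
    rw [erase_insert_of_ne hja, prod_insert (fun hm => ha (mem_of_mem_erase hm))]
    ring

variable [Fintype ι]

theorem derivation_prod_eq_weightedDeriv (h : ι → A) :
    D (∏ j, h j) = weightedDeriv D h 1 := by
  simp [weightedDeriv, derivation_prod]

theorem derivation_prod_pow (h : ι → A) (k : ι → ℕ) (hk : ∀ j, 1 ≤ k j) :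
    D (∏ j, h j ^ k j) =
      (∏ j, h j ^ (k j - 1)) * weightedDeriv D h (fun j => (k j : K)) := by
  rw [derivation_prod, weightedDeriv, mul_sum]
  refine sum_congr rfl fun j _ => ?_
  have hpow : ∏ i ∈ univ.erase j, h i ^ k i =
      (∏ i ∈ univ.erase j, h i ^ (k i - 1)) * ∏ i ∈ univ.erase j, h i := by
    rw [← prod_mul_distrib]
    exact prod_congr rfl fun i _ => (pow_sub_one_mul (Nat.one_le_iff_ne_zero.1 (hk i)) _).symm
  rw [hpow, ← mul_prod_erase univ (fun i => h i ^ (k i - 1)) (mem_univ j), Derivation.leibniz_pow,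
    nsmul_eq_mul, smul_eq_mul, Algebra.smul_def, map_natCast]
  ring

theorem smul_weightedDeriv_one_sub (h : ι → A) (c : ι → K) (l : K) :
    l • weightedDeriv D h 1 - weightedDeriv D h c = weightedDeriv D h (fun j => l - c j) := by
  simp only [weightedDeriv, smul_sum, ← sum_sub_distrib, sub_smul, Pi.one_apply, one_smul]

theorem exists_weightedDeriv_eq (h : ι → A) (c : ι → K) (j : ι) :
    ∃ q, weightedDeriv D h c = h j * q + c j • (D (h j) * ∏ i ∈ univ.erase j, h i) := by
  have hdvd : h j ∣ ∑ i ∈ univ.erase j, c i • (D (h i) * ∏ m ∈ univ.erase i, h m) := by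
    refine dvd_sum fun i hi => dvd_smul_of_dvd _ (dvd_mul_of_dvd_right ?_ _)
    exact dvd_prod_of_mem h (mem_erase.2 ⟨(ne_of_mem_erase hi).symm, mem_univ _⟩)
  obtain ⟨q, hq⟩ := hdvd
  exact ⟨q, by rw [← hq, weightedDeriv, sum_erase_add _ _ (mem_univ j)]⟩

theorem dvd_weightedDeriv (h : ι → A) (c : ι → K) (j : ι) (hc : c j = 0) :
    h j ∣ weightedDeriv D h c := by
  obtain ⟨q, hq⟩ := exists_weightedDeriv_eq D h c j
  exact ⟨q, by rw [hq, hc, zero_smul, add_zero]⟩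

variable [DecompositionMonoid A] {h : ι → A}

theorem isRelPrime_weightedDeriv (hcop : Pairwise fun i j => IsRelPrime (h i) (h j))
    (hD : ∀ j, IsRelPrime (h j) (D (h j))) (c : ι → K) (j : ι) (hc : c j ≠ 0) :
    IsRelPrime (h j) (weightedDeriv D h c) := by
  obtain ⟨q, hq⟩ := exists_weightedDeriv_eq D h c j
  have hterm : IsRelPrime (h j) (c j • (D (h j) * ∏ i ∈ univ.erase j, h i)) := by
    rw [Algebra.smul_def, isRelPrime_mul_unit_left_right ((IsUnit.mk0 _ hc).map (algebraMap K A))]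
    exact (hD j).mul_right (IsRelPrime.prod_right fun i hi => hcop (ne_of_mem_erase hi).symm)
  intro d hd hdw
  rw [hq] at hdw
  exact hterm hd ((dvd_add_right (dvd_mul_of_dvd_left hd q)).1 hdw)

theorem isRelPrime_prod_weightedDeriv (hcop : Pairwise fun i j => IsRelPrime (h i) (h j))
    (hD : ∀ j, IsRelPrime (h j) (D (h j))) (c : ι → K) (s : Finset ι) (hc : ∀ j ∈ s, c j ≠ 0) :
    IsRelPrime (∏ j ∈ s, h j) (weightedDeriv D h c) :=
  IsRelPrime.prod_left fun j hj => isRelPrime_weightedDeriv D hcop hD c j (hc j hj)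

theorem dvd_of_dvd_prod_of_dvd_weightedDeriv (hcop : Pairwise fun i j => IsRelPrime (h i) (h j))
    (hD : ∀ j, IsRelPrime (h j) (D (h j))) (c : ι → K) (j : ι) (hc : ∀ i, i ≠ j → c i ≠ 0)
    {d : A} (hd : d ∣ ∏ i, h i) (hdw : d ∣ weightedDeriv D h c) : d ∣ h j := by
  rw [← mul_prod_erase univ h (mem_univ j)] at hd
  refine IsRelPrime.dvd_of_dvd_mul_right ?_ hd
  exact ((isRelPrime_prod_weightedDeriv D hcop hD c (univ.erase j)
    fun i hi => hc i (ne_of_mem_erase hi)).of_dvd_right hdw).symm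

end Derivation

/-- The directional derivative `dirDeriv z` as a derivation. -/
noncomputable def dirDerivation {ℓ : ℕ} (z : Fin ℓ → ℂ) :
    Derivation ℂ (MvPolynomial (Fin ℓ) ℂ) (MvPolynomial (Fin ℓ) ℂ) :=
  ∑ i, z i • MvPolynomial.pderiv i

theorem dirDeriv_eq_dirDerivation {ℓ : ℕ} (z : Fin ℓ → ℂ) (p : MvPolynomial (Fin ℓ) ℂ) :
    dirDeriv z p = dirDerivation z p := by
  have hsum := congrFun (map_sum Derivation.coeFnAddMonoidHom
    (fun i => z i • MvPolynomial.pderiv (R := ℂ) i) univ) p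
  simp only [Derivation.coeFnAddMonoidHom_apply, Finset.sum_apply, Derivation.smul_apply,
    MvPolynomial.smul_eq_C_mul] at hsum
  exact hsum.symm

/-- The cofactors of a gcd of `f` and `D f`, for `f = α • ∏ j, h j ^ k j`, are the squarefree part
of `f` and the weighted derivative of its factors, up to a common constant. -/
theorem exists_cofactors_eq {ι σ K : Type*} [Fintype ι] [DecidableEq ι] [Field K] [CharZero K]
    (D : Derivation K (MvPolynomial σ K) (MvPolynomial σ K)) {h : ι → MvPolynomial σ K}
    (hcop : Pairwise fun i j => IsRelPrime (h i) (h j)) (hD : ∀ j, IsRelPrime (h j) (D (h j)))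
    (hne : ∀ j, h j ≠ 0) {k : ι → ℕ} (hk : ∀ j, 1 ≤ k j) {α : K} (hα : α ≠ 0)
    {f u v w : MvPolynomial σ K} (hfact : f = α • ∏ j, h j ^ k j)
    (hgcd : ∀ d, d ∣ f → d ∣ D f → d ∣ u) (hv : f = u * v) (hw : D f = u * w) :
    ∃ β : K, β ≠ 0 ∧ v = β • ∏ j, h j ∧ w = β • weightedDeriv D h (fun j => (k j : K)) := by
  set U := ∏ j, h j ^ (k j - 1) with hU
  set W := weightedDeriv D h (fun j => (k j : K))
  have hUne : U ≠ 0 := prod_ne_zero_iff.2 fun j _ => pow_ne_zero _ (hne j)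
  have hf : f = U * α • ∏ j, h j := by
    rw [hfact, hU, mul_smul_comm, ← prod_mul_distrib]
    congr 1
    exact prod_congr rfl fun i _ => (pow_sub_one_mul (Nat.one_le_iff_ne_zero.1 (hk i)) _).symm
  have hDf : D f = U * α • W := by
    rw [hfact, D.map_smul, derivation_prod_pow D h k hk, mul_smul_comm]
  obtain ⟨c, hc⟩ := hgcd U ⟨_, hf⟩ ⟨_, hDf⟩
  have hcv : α • ∏ j, h j = c * v :=
    mul_left_cancel₀ hUne (by rw [← hf, hv, hc, mul_assoc])
  have hcw : α • W = c * w :=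
    mul_left_cancel₀ hUne (by rw [← hDf, hw, hc, mul_assoc])
  have hdvd : ∀ {p q : MvPolynomial σ K}, α • p = c * q → c ∣ p := fun {p q} e =>
    ⟨α⁻¹ • q, by rw [mul_smul_comm, ← e, inv_smul_smul₀ hα]⟩
  have hcunit : IsUnit c := isRelPrime_prod_weightedDeriv D hcop hD _ univ
    (fun j _ => Nat.cast_ne_zero.2 (Nat.one_le_iff_ne_zero.1 (hk j))) (hdvd hcv) (hdvd hcw)
  obtain ⟨γ, hγ, rfl⟩ := MvPolynomial.isUnit_iff_eq_C_of_isReduced.1 hcunit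
  have hsolve : ∀ {p q : MvPolynomial σ K}, α • p = MvPolynomial.C γ * q → q = (γ⁻¹ * α) • p :=
    fun {p q} e => by
      rw [mul_smul, e, ← MvPolynomial.smul_eq_C_mul, inv_smul_smul₀ hγ.ne_zero]
  exact ⟨γ⁻¹ * α, mul_ne_zero (inv_ne_zero hγ.ne_zero) hα, hsolve hcv, hsolve hcw⟩

/-- The GCD lemma underlying numerical squarefree factorization: if
`f = C α · h_1^{k_1}⋯h_r^{k_r}` is a squarefree factorization with pairwise distinct
multiplicities, `z` is a direction with `∂_z h_j ≠ 0` and `h_j` coprime to `∂_z h_j` for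
all `j`, `u = gcd(f, ∂_z f)` with cofactors `f = u·v`, `∂_z f = u·w`, then for every `l`:
`gcd(v, l·∂_z v − w) = h_j` if `l = k_j`, and `gcd(v, l·∂_z v − w) = 1` if
`l ∉ {k_1,…,k_r}`. -/
theorem squarefree_factor_gcd (ℓ : ℕ) (f : MvPolynomial (Fin ℓ) ℂ)
    (hf : 0 < f.totalDegree)
    (r : ℕ) (hr : 1 ≤ r) (α : ℂ) (hα : α ≠ 0)
    (h : Fin r → MvPolynomial (Fin ℓ) ℂ) (k : Fin r → ℕ)
    (hk : ∀ j, 1 ≤ k j) (hkdist : ∀ i j : Fin r, i ≠ j → k i ≠ k j)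
    (hhnc : ∀ j, 0 < (h j).totalDegree) (hsf : ∀ j, Squarefree (h j))
    (hcop : ∀ i j : Fin r, i ≠ j → IsRelPrime (h i) (h j))
    (hfact : f = MvPolynomial.C α * ∏ j, h j ^ k j)
    (z : Fin ℓ → ℂ)
    (hdz : ∀ j, dirDeriv z (h j) ≠ 0)
    (hcopd : ∀ j, IsRelPrime (h j) (dirDeriv z (h j)))
    (u v w : MvPolynomial (Fin ℓ) ℂ)
    (hu1 : u ∣ f) (hu2 : u ∣ dirDeriv z f)
    (hu3 : ∀ d : MvPolynomial (Fin ℓ) ℂ, d ∣ f → d ∣ dirDeriv z f → d ∣ u)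
    (hv : f = u * v) (hw : dirDeriv z f = u * w) :
    (∀ (l : ℕ) (j : Fin r), l = k j →
      h j ∣ v ∧ h j ∣ (MvPolynomial.C (l : ℂ) * dirDeriv z v - w) ∧
      (∀ d : MvPolynomial (Fin ℓ) ℂ, d ∣ v →
        d ∣ (MvPolynomial.C (l : ℂ) * dirDeriv z v - w) → d ∣ h j)) ∧
    (∀ l : ℕ, (∀ j : Fin r, l ≠ k j) →
      IsRelPrime v (MvPolynomial.C (l : ℂ) * dirDeriv z v - w)) := by
  simp only [dirDeriv_eq_dirDerivation] at *
  set D := dirDerivation z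
  have hpair : Pairwise fun i j => IsRelPrime (h i) (h j) := fun i j => hcop i j
  have hne : ∀ j, h j ≠ 0 := fun j => (hsf j).ne_zero
  rw [← MvPolynomial.smul_eq_C_mul] at hfact
  obtain ⟨β, hβ, hvβ, hwβ⟩ := exists_cofactors_eq D hpair hcopd hne hk hα hfact hu3 hv hw
  have hβdvd : ∀ d p : MvPolynomial (Fin ℓ) ℂ, d ∣ β • p → d ∣ p := fun d p hd => by
    simpa only [inv_smul_smul₀ hβ] using dvd_smul_of_dvd β⁻¹ hd
  have hcomb : ∀ l : ℕ, MvPolynomial.C (l : ℂ) * D v - w =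
      β • weightedDeriv D h (fun j => (l : ℂ) - k j) := fun l => by
    rw [hvβ, hwβ, D.map_smul, derivation_prod_eq_weightedDeriv, ← MvPolynomial.smul_eq_C_mul,
      smul_comm, ← smul_sub, smul_weightedDeriv_one_sub]
  constructor
  · rintro l j rfl
    rw [hcomb, hvβ]
    refine ⟨dvd_smul_of_dvd _ (dvd_prod_of_mem h (mem_univ j)),
      dvd_smul_of_dvd _ (dvd_weightedDeriv D h _ j (sub_self _)), fun d hd hdw => ?_⟩
    exact dvd_of_dvd_prod_of_dvd_weightedDeriv D hpair hcopd _ j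
      (fun i hi => sub_ne_zero.2 (Nat.cast_injective.ne (hkdist j i hi.symm)))
      (hβdvd _ _ hd) (hβdvd _ _ hdw)
  · intro l hl
    rw [hcomb, hvβ]
    intro d hd hdw
    exact isRelPrime_prod_weightedDeriv D hpair hcopd _ univ
      (fun j _ => sub_ne_zero.2 (Nat.cast_injective.ne (hl j)))
      (hβdvd _ _ hd) (hβdvd _ _ hdw)
end
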